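/- arXiv:2310.06267 — 3 statements merged into one kernel-verified Lean document; each statement's English description precedes it below -/
import Mathlib

section
/- Every Shi part of W has a smallest element with respect to the weak order ⪯. -/
/-!
Let `(W,S)` be a Coxeter system, given by a Coxeter matrix `M : CoxeterMatrix B`
and `cs : CoxeterSystem M W`; the set `S` of simple reflections is the range of
`cs.simple`, and `S` is finite since `B` is finite.
-/

variable {B W : Type*} [Group W] {M : CoxeterMatrix B}

/-- The weak order on `W`: `p ⪯ g` iff `ℓ(p) + ℓ(p⁻¹g) = ℓ(g)`. -/
def WeakLe (cs : CoxeterSystem M W) (p g : W) : Prop :=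
  cs.length p + cs.length (p⁻¹ * g) = cs.length g

/-- `f ∈ W` is adjacent to the wall of the reflection `r` if `f⁻¹rf ∈ S`. -/
def AdjWall (cs : CoxeterSystem M W) (f r : W) : Prop :=
  ∃ i : B, f⁻¹ * r * f = cs.simple i

/-- The reflection `q` separates the identity from the wall of the reflection `r`
if `ℓ(qf) < ℓ(f)` for every `f` adjacent to the wall of `r`. -/
def SepIdWall (cs : CoxeterSystem M W) (q r : W) : Prop :=
  cs.IsReflection q ∧ ∀ f : W, AdjWall cs f r → cs.length (q * f) < cs.length f

/-- A reflection `r` is elementary if no reflection separates the identity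
from the wall of `r`. -/
def IsElementary (cs : CoxeterSystem M W) (r : W) : Prop :=
  cs.IsReflection r ∧ ¬ ∃ q : W, SepIdWall cs q r

/-- One step `g → gs` (with `s ∈ S`) crossing a non-elementary wall `gsg⁻¹ ∉ ℰ`. -/
def ShiStep (cs : CoxeterSystem M W) (g h : W) : Prop :=
  ∃ i : B, h = g * cs.simple i ∧ ¬ IsElementary cs (g * cs.simple i * g⁻¹)

/-- `g` and `h` lie in the same Shi part: there is a sequence `g = g₀, …, gₙ = h`
with `gᵢ₊₁ = gᵢsᵢ`, `sᵢ ∈ S`, and `gᵢsᵢgᵢ⁻¹ ∉ ℰ`. -/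
def SameShiPart (cs : CoxeterSystem M W) : W → W → Prop :=
  Relation.ReflTransGen (ShiStep cs)

namespace ShiAux

open CoxeterSystem

section
open Classical in
/-- signed action of a simple reflection -/
noncomputable def sg (cs : CoxeterSystem M W) (i : B) : Function.End (W × ZMod 2) :=
  fun u => (cs.simple i * u.1 * cs.simple i, u.2 + if u.1 = cs.simple i then 1 else 0)

variable (cs : CoxeterSystem M W)

open Classical in
lemma sg_pow (i j : B) (k : ℕ) (u : W) (e : ZMod 2) :
    ((sg cs i * sg cs j) ^ k) (u, e) =
      ((cs.simple i * cs.simple j) ^ k * u * ((cs.simple i * cs.simple j) ^ k)⁻¹,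
        e + ∑ l ∈ Finset.range (2 * k),
          if u = ((cs.simple i * cs.simple j) ^ (l+1))⁻¹ * cs.simple i then 1 else 0) := by
  induction k with
  | zero => simp; rfl
  | succ k ih =>
    rw [pow_succ']
    have : ∀ (f g : Function.End (W × ZMod 2)) z, (f * g) z = f (g z) := fun _ _ _ => rfl
    rw [this, ih, this]
    have hss : ∀ i, (cs.simple i)⁻¹ = cs.simple i := cs.inv_simple
    generalize hx : (cs.simple i * cs.simple j) = x
    have hj : cs.simple j = x⁻¹ * cs.simple i := by
      rw [← hx]; simp
    have hi : cs.simple i * x⁻¹ = x * cs.simple i := by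
      rw [← hx]; simp [mul_assoc]
    have hi2 : cs.simple i * x = x⁻¹ * cs.simple i := by
      rw [← hx]; simp [mul_assoc]
    have hik : ∀ n : ℕ, cs.simple i * x ^ n = (x ^ n)⁻¹ * cs.simple i := by
      intro n
      induction n with
      | zero => simp
      | succ n ihn =>
        rw [pow_succ, ← mul_assoc, ihn, mul_assoc, hi2, mul_inv_rev, ← mul_assoc,
          ← mul_inv_rev, ← mul_inv_rev, ← pow_succ, ← pow_succ']
    have e1 : (x ^ k * u * (x ^ k)⁻¹ = cs.simple j) ↔ u = (x ^ (2 * k + 1))⁻¹ * cs.simple i := by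
      rw [mul_inv_eq_iff_eq_mul, ← eq_inv_mul_iff_mul_eq, hj, mul_assoc, hik]
      have : (x ^ k)⁻¹ * (x⁻¹ * ((x ^ k)⁻¹ * cs.simple i)) = (x ^ (2 * k + 1))⁻¹ * cs.simple i := by
        rw [← mul_assoc, ← mul_assoc]; congr 1; group
      rw [this]
    have e2 : (cs.simple j * (x ^ k * u * (x ^ k)⁻¹) * cs.simple j = cs.simple i) ↔
        u = (x ^ (2 * k + 1 + 1))⁻¹ * cs.simple i := by
      have a1 : (cs.simple j * (x ^ k * u * (x ^ k)⁻¹) * cs.simple j = cs.simple i) ↔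
        x ^ k * u * (x ^ k)⁻¹ = cs.simple j * cs.simple i * cs.simple j := by
        constructor
        · intro h; rw [← h]; simp [mul_assoc]
        · intro h; rw [h]; simp [mul_assoc]
      have a2 : cs.simple j * cs.simple i * cs.simple j = x⁻¹ * x⁻¹ * cs.simple i := by
        rw [hj]; simp [mul_assoc]
      rw [a1, mul_inv_eq_iff_eq_mul, ← eq_inv_mul_iff_mul_eq, a2, mul_assoc, hik]
      have : (x ^ k)⁻¹ * (x⁻¹ * x⁻¹ * ((x ^ k)⁻¹ * cs.simple i))
          = (x ^ (2 * k + 1 + 1))⁻¹ * cs.simple i := by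
        rw [← mul_assoc, ← mul_assoc]; congr 1; group
      rw [this]
    rw [show 2 * (k + 1) = 2 * k + 1 + 1 by ring, Finset.sum_range_succ, Finset.sum_range_succ]
    simp only [sg, e1, e2]
    refine Prod.ext ?_ ?_
    · simp only
      have : x ^ (k+1) = cs.simple i * cs.simple j * x ^ k := by rw [hx, pow_succ']
      rw [this]; simp [mul_assoc]
    · simp only; ring

lemma sg_liftable : M.IsLiftable (sg cs) := by
  classical
  intro i j
  funext ⟨u, e⟩
  rw [sg_pow]
  have hx := cs.simple_mul_simple_pow i j
  rw [hx, two_mul, Finset.sum_range_add]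
  have : ∀ l, (cs.simple i * cs.simple j) ^ (M i j + l + 1)
    = (cs.simple i * cs.simple j) ^ (l + 1) := by
    intro l; rw [add_assoc, pow_add, hx, one_mul]
  simp only [this, CharTwo.add_self_eq_zero]
  simp
  rfl

/-- the signed representation -/
noncomputable def sgn : W →* Function.End (W × ZMod 2) := cs.lift ⟨sg cs, sg_liftable cs⟩

/-- parity of the number of occurrences of `t` in the right inversion sequence -/
noncomputable def par (w t : W) : ZMod 2 := (sgn cs w (t, 0)).2

lemma sgn_simple (i : B) : sgn cs (cs.simple i) = sg cs i :=
  cs.lift_apply_simple (sg_liftable cs) i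

lemma sgn_eq (w t : W) (e : ZMod 2) : sgn cs w (t, e) = (w * t * w⁻¹, e + par cs w t) := by
  unfold par
  have h1 : ∀ (f g : Function.End (W × ZMod 2)) z, (f * g) z = f (g z) := fun _ _ _ => rfl
  induction w using cs.simple_induction_left generalizing t e with
  | one => rw [map_one]; simp [Function.End.one_def]
  | mul_simple_left w i ih =>
    rw [map_mul, h1, h1, ih, ih t 0, sgn_simple]
    simp [sg, mul_assoc, add_assoc]

lemma par_mul (g h t : W) : par cs (g * h) t = par cs h t + par cs g (h * t * h⁻¹) := by
  have h1 : ∀ (f g : Function.End (W × ZMod 2)) z, (f * g) z = f (g z) := fun _ _ _ => rfl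
  have := sgn_eq cs (g * h) t 0
  rw [map_mul, h1, sgn_eq, sgn_eq] at this
  simpa using (congrArg Prod.snd this).symm

open Classical in
lemma par_simple (i : B) (t : W) : par cs (cs.simple i) t = if t = cs.simple i then 1 else 0 := by
  unfold par; rw [sgn_simple]; simp [sg]

lemma par_one (t : W) : par cs 1 t = 0 := by
  unfold par; rw [map_one]; rfl

lemma mem_of_par (ω : List B) (t : W) (h : par cs (cs.wordProd ω) t ≠ 0) :
    t ∈ cs.rightInvSeq ω := by
  induction ω with
  | nil => simp [par_one] at h
  | cons i ω ih =>
    rw [cs.wordProd_cons, par_mul, par_simple] at h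
    simp only [CoxeterSystem.rightInvSeq, List.mem_cons]
    by_cases h2 : par cs (cs.wordProd ω) t = 0
    · left
      rw [h2] at h
      have : cs.wordProd ω * t * (cs.wordProd ω)⁻¹ = cs.simple i := by
        by_contra h3; simp [h3] at h
      rw [← this]; group
    · exact Or.inr (ih h2)

lemma par_self {t : W} (ht : cs.IsReflection t) : par cs t t = 1 := by
  obtain ⟨w, i, rfl⟩ := ht
  have h0 := par_mul cs w w⁻¹ (w * cs.simple i * w⁻¹)
  rw [mul_inv_cancel, par_one] at h0
  have e : w⁻¹ * (w * cs.simple i * w⁻¹) * w⁻¹⁻¹ = cs.simple i := by group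
  rw [e] at h0
  rw [par_mul, e, par_mul, par_simple]
  have e3 : cs.simple i * cs.simple i * (cs.simple i)⁻¹ = cs.simple i := by group
  rw [e3, if_pos rfl]
  linear_combination -h0

lemma lt_of_par {t w : W} (h : par cs w t ≠ 0) : cs.length (w * t) < cs.length w := by
  obtain ⟨ω, hω, rfl⟩ := cs.exists_isReduced w
  exact (cs.isRightInversion_of_mem_rightInvSeq hω (mem_of_par cs ω t h)).2

lemma par_iff {t w : W} (ht : cs.IsReflection t) :
    cs.length (w * t) < cs.length w ↔ par cs w t = 1 := by
  constructor
  · intro h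
    by_contra h2
    have h3 : par cs w t = 0 := by
      revert h2; generalize par cs w t = z; revert z; decide
    have h4 : par cs (w * t) t ≠ 0 := by
      rw [par_mul, par_self cs ht]
      have : t * t * t⁻¹ = t := by group
      rw [this, h3]; decide
    have := lt_of_par cs h4
    rw [mul_assoc, ht.mul_self, mul_one] at this
    omega
  · intro h; apply lt_of_par; rw [h]; decide

/-- `r` separates `1` from `f` -/
def Sep (r f : W) : Prop := cs.length (r * f) < cs.length f

lemma sep_iff {r f : W} (hr : cs.IsReflection r) : Sep cs r f ↔ par cs f⁻¹ r = 1 := by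
  rw [← par_iff cs hr, cs.length_inv, ← cs.length_inv, mul_inv_rev, inv_inv, hr.inv, Sep]

lemma sep_mul {r f g : W} (hr : cs.IsReflection r) :
    Sep cs r (f * g) ↔ ¬ (Sep cs r f ↔ Sep cs (f⁻¹ * r * f) g) := by
  have hr2 : cs.IsReflection (f⁻¹ * r * f) := by simpa using hr.conj f⁻¹
  rw [sep_iff cs hr, sep_iff cs hr, sep_iff cs hr2, mul_inv_rev, par_mul, inv_inv]
  generalize par cs f⁻¹ r = a
  generalize par cs g⁻¹ (f⁻¹ * r * f) = b
  revert a b; decide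

lemma sep_simple {r : W} (hr : cs.IsReflection r) (i : B) :
    Sep cs r (cs.simple i) ↔ r = cs.simple i := by
  rw [sep_iff cs hr, cs.inv_simple, par_simple]
  split_ifs <;> simp_all

lemma sep_mul_simple {r f : W} (hr : cs.IsReflection r) (i : B) :
    Sep cs r (f * cs.simple i) ↔ ¬ (Sep cs r f ↔ r = f * cs.simple i * f⁻¹) := by
  have hr2 : cs.IsReflection (f⁻¹ * r * f) := by simpa using hr.conj f⁻¹
  rw [sep_mul cs hr, sep_simple cs hr2]
  have : f⁻¹ * r * f = cs.simple i ↔ r = f * cs.simple i * f⁻¹ := by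
    constructor
    · intro h; rw [← h]; group
    · intro h; rw [h]; group
  rw [this]

lemma not_sep_one (r : W) : ¬ Sep cs r 1 := by simp [Sep]

end

section
variable (cs : CoxeterSystem M W)

lemma conj_refl {r : W} (hr : cs.IsReflection r) {e : W} (he : cs.IsReflection e) :
    cs.IsReflection (e * r * e) := by
  have := hr.conj e
  rwa [he.inv] at this

lemma exists_cross (n : ℕ) : ∀ {f r : W}, cs.length f ≤ n → cs.IsReflection r → Sep cs r f →
    ∃ g i, r = g * cs.simple i * g⁻¹ ∧ (∀ q, cs.IsReflection q → Sep cs q g → Sep cs q f) ∧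
      (∀ q, cs.IsReflection q → Sep cs q (g * cs.simple i) → Sep cs q f) := by
  induction n with
  | zero =>
    intro f r hf hr h
    unfold Sep at h; omega
  | succ n ih =>
    intro f r hf hr h
    have hf1 : f ≠ 1 := by rintro rfl; exact not_sep_one cs r h
    obtain ⟨i, hi⟩ := cs.exists_rightDescent_of_ne_one hf1
    obtain ⟨f', rfl⟩ : ∃ f', f = f' * cs.simple i := ⟨f * cs.simple i, by simp⟩
    have hi' : cs.length f' < cs.length (f' * cs.simple i) := by
      simpa [CoxeterSystem.IsRightDescent] using hi
    have hw : ¬ Sep cs (f' * cs.simple i * f'⁻¹) f' := by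
      unfold Sep; simp only [inv_mul_cancel_right]; omega
    have hsub : ∀ q, cs.IsReflection q → Sep cs q f' → Sep cs q (f' * cs.simple i) := by
      intro q hq hqf
      rw [sep_mul_simple cs hq]
      intro h2
      rw [h2.1 hqf] at hqf
      exact hw hqf
    by_cases hrf : Sep cs r f'
    · obtain ⟨g, k, h1, h2, h3⟩ := ih (by omega) hr hrf
      exact ⟨g, k, h1, fun q hq hh => hsub q hq (h2 q hq hh), fun q hq hh => hsub q hq (h3 q hq hh)⟩
    · have h' := h
      rw [sep_mul_simple cs hr] at h'
      refine ⟨f', i, by tauto, hsub, fun q _ h => h⟩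

lemma sep_of_sepIdWall {q r f : W} (hr : cs.IsReflection r) (h : SepIdWall cs q r)
    (hf : Sep cs r f) : Sep cs q f := by
  obtain ⟨g, i, rfl, h2, -⟩ := exists_cross cs _ le_rfl hr hf
  exact h2 q h.1 (h.2 g ⟨i, by group⟩)

lemma lemL {e q f : W} (he : cs.IsReflection e) (hq : cs.IsReflection q) (h1 : ¬ Sep cs q f)
    (h2 : Sep cs q (e * f)) (h3 : Sep cs q e) : ¬ Sep cs e f := by
  intro h
  obtain ⟨g, i, hg, h4, h5⟩ := exists_cross cs _ le_rfl he h
  have heg : g * cs.simple i = e * g := by rw [hg]; group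
  rw [heg] at h5
  have h6 := mt (h5 q hq) h1
  rw [sep_mul cs hq] at h6 h2
  have hq2 : cs.IsReflection (e⁻¹ * q * e) := by simpa using hq.conj e⁻¹
  have := h4 _ hq2
  tauto

lemma lemU {e r : W} (he : cs.IsReflection e) (hr : cs.IsReflection r)
    (hne : ¬ IsElementary cs r)
    (hs : ∀ f, AdjWall cs f (e * r * e) → Sep cs e f ∨ Sep cs r f) :
    ¬ IsElementary cs (e * r * e) := by
  have : ∃ q, SepIdWall cs q r := by
    by_contra h; exact hne ⟨hr, h⟩
  obtain ⟨q, hq⟩ := this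
  rintro ⟨-, h0⟩
  apply h0
  have key : ∀ f, AdjWall cs f (e * r * e) → Sep cs q (e * f) := by
    rintro f ⟨i, hi⟩
    refine hq.2 _ ⟨i, ?_⟩
    rw [← hi, mul_inv_rev, he.inv]; simp only [mul_assoc]
  by_cases hqe : Sep cs q e
  · refine ⟨q, hq.1, fun f hf => ?_⟩
    by_contra hqf
    have h1 := lemL cs he hq.1 hqf (key f hf) hqe
    have h2 := mt (sep_of_sepIdWall cs hr hq) hqf
    have := hs f hf
    tauto
  · refine ⟨e * q * e, conj_refl cs hq.1 he, fun f hf => ?_⟩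
    have := key f hf
    rw [sep_mul cs hq.1, he.inv] at this
    change Sep cs _ f
    tauto

end

set_option linter.unusedSectionVars false

section dih
variable {G : Type*} [Group G]

open Classical in
/-- gallery in the dihedral subgroup -/
noncomputable def da (s t : G) (k : ℤ) : G := (s * t) ^ (k / 2) * if Even k then 1 else s

open Classical in
/-- type of the k-th edge -/
noncomputable def dc (s t : G) (k : ℤ) : G := if Even k then s else t

variable {s t : G} (hs : s * s = 1) (ht : t * t = 1)
include hs ht

lemma s_zpow (k : ℤ) : s * (s * t) ^ k = (s * t) ^ (-k) * s := by
  have h1 : s⁻¹ = s := inv_eq_of_mul_eq_one_left hs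
  have h2 : t⁻¹ = t := inv_eq_of_mul_eq_one_left ht
  have : s * (s * t) ^ k * s⁻¹ = (s * t) ^ (-k) := by
    rw [← conj_zpow, zpow_neg, ← inv_zpow, mul_inv_rev, h1, h2]
    congr 1
    rw [← mul_assoc, hs, one_mul]
  rw [← this]; simp

lemma da_succ (k : ℤ) : da s t (k + 1) = da s t k * dc s t k := by
  unfold da dc
  rcases Int.even_or_odd k with h | h
  · have h2 : ¬ Even (k+1) := by rw [Int.even_add_one]; simpa using h
    rw [if_pos h, if_pos h, if_neg h2]
    have : (k+1)/2 = k/2 := by obtain ⟨m, rfl⟩ := h; omega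
    rw [this, mul_one]
  · have h1 := Int.not_even_iff_odd.2 h
    have h2 : Even (k+1) := by rw [Int.even_add_one]; simpa using h
    rw [if_neg h1, if_neg h1, if_pos h2]
    have : (k+1)/2 = k/2 + 1 := by obtain ⟨m, rfl⟩ := h; omega
    rw [this, zpow_add_one]; simp [mul_assoc]

lemma da_zero : da s t 0 = 1 := by simp [da]

lemma dc_mul (k : ℤ) : dc s t k * dc s t k = 1 := by
  unfold dc; split_ifs <;> assumption

lemma dc_pred (k : ℤ) : (dc s t k = s ∧ dc s t (k-1) = t) ∨ (dc s t k = t ∧ dc s t (k-1) = s) := by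
  unfold dc
  have : Even (k - 1) ↔ ¬ Even k := by
    rw [Int.even_sub]; simp
  by_cases h : Even k
  · left; rw [if_pos h, if_neg (by tauto)]; simp
  · right; rw [if_neg h, if_pos (by tauto)]; simp

lemma da_pred (k : ℤ) : da s t (k - 1) = da s t k * dc s t (k - 1) := by
  have := da_succ hs ht (k - 1)
  rw [sub_add_cancel] at this
  rw [this, mul_assoc, dc_mul hs ht, mul_one]

lemma da_wall (k : ℤ) : da s t k * dc s t k * (da s t k)⁻¹ = (s * t) ^ k * s := by
  have hsz := s_zpow hs ht
  have h1 : s⁻¹ = s := inv_eq_of_mul_eq_one_left hs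
  rw [mul_inv_eq_iff_eq_mul]
  unfold da dc
  rcases Int.even_or_odd k with h | h
  · rw [if_pos h, if_pos h]
    obtain ⟨m, rfl⟩ := h
    have : (m + m)/2 = m := by omega
    rw [this, mul_one, mul_assoc _ s, hsz, ← mul_assoc, ← zpow_add]
    simp
  · have h1 := Int.not_even_iff_odd.2 h
    rw [if_neg h1, if_neg h1]
    obtain ⟨m, rfl⟩ := h
    have : (2 * m + 1)/2 = m := by omega
    rw [this, mul_assoc _ s t, mul_assoc _ s, ← mul_assoc s, hsz, mul_assoc _ s s, hs, mul_one,
      ← zpow_add, ← zpow_add_one]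
    congr 1; ring

lemma da_mem (k : ℤ) : da s t k ∈ Subgroup.closure {s, t} := by
  have h1 : s ∈ Subgroup.closure {s, t} := Subgroup.subset_closure (by simp)
  have h2 : t ∈ Subgroup.closure {s, t} := Subgroup.subset_closure (by simp)
  unfold da
  refine mul_mem (zpow_mem (mul_mem h1 h2) _) ?_
  split_ifs
  · exact one_mem _
  · exact h1

lemma rho_mem (k : ℤ) : (s * t) ^ k * s ∈ Subgroup.closure {s, t} := by
  have h1 : s ∈ Subgroup.closure {s, t} := Subgroup.subset_closure (by simp)
  have h2 : t ∈ Subgroup.closure {s, t} := Subgroup.subset_closure (by simp)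
  exact mul_mem (zpow_mem (mul_mem h1 h2) _) h1

lemma exists_da {w : G} (hw : w ∈ Subgroup.closure {s, t}) : ∃ k, w = da s t k := by
  have h1 : s⁻¹ = s := inv_eq_of_mul_eq_one_left hs
  have h2 : t⁻¹ = t := inv_eq_of_mul_eq_one_left ht
  have key : ∀ k, ∀ y ∈ ({s, t} : Set G), ∃ m, da s t k * y = da s t m := by
    rintro k y hy
    have := da_succ hs ht k
    have := da_pred hs ht k
    rcases hy with rfl | rfl <;> rcases dc_pred hs ht k with ⟨h, h'⟩ | ⟨h, h'⟩
    · exact ⟨k + 1, by rw [da_succ hs ht, h]⟩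
    · exact ⟨k - 1, by rw [da_pred hs ht, h']⟩
    · exact ⟨k - 1, by rw [da_pred hs ht, h']⟩
    · exact ⟨k + 1, by rw [da_succ hs ht, h]⟩
  induction hw using Subgroup.closure_induction_right with
  | one => exact ⟨0, (da_zero hs ht).symm⟩
  | mul_right x hx y hy ih =>
    obtain ⟨k, rfl⟩ := ih
    exact key k y hy
  | mul_inv_cancel x hx y hy ih =>
    obtain ⟨k, rfl⟩ := ih
    have : y⁻¹ = y := by rcases hy with rfl | rfl <;> assumption
    rw [this]
    exact key k y hy

lemma da_period (k m : ℤ) : da s t (k + 2 * orderOf (s * t) * m) = da s t k := by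
  unfold da
  have : Even (k + 2 * orderOf (s * t) * m) ↔ Even k := by
    rw [Int.even_add, mul_assoc]; simp
  simp only [this]
  rw [mul_assoc, Int.add_mul_ediv_left _ _ (by norm_num), zpow_add, zpow_mul, zpow_natCast,
    pow_orderOf_eq_one, one_zpow, mul_one]

lemma exists_da' {w : G} (hw : w ∈ Subgroup.closure {s, t}) :
    ∃ k : ℤ, w = da s t k ∧ (0 < orderOf (s * t) → 0 ≤ k ∧ k < 2 * orderOf (s * t)) := by
  obtain ⟨k, rfl⟩ := exists_da hs ht hw
  by_cases h : 0 < orderOf (s * t)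
  · refine ⟨k % (2 * orderOf (s * t)), ?_, fun _ => ⟨Int.emod_nonneg _ (by omega),
      Int.emod_lt_of_pos _ (by omega)⟩⟩
    conv_lhs => rw [← Int.emod_add_mul_ediv k (2 * orderOf (s * t))]
    rw [da_period hs ht]
  · exact ⟨k, rfl, fun h' => absurd h' h⟩

lemma rho_eq (j k : ℤ) : (s * t) ^ j * s = (s * t) ^ k * s ↔ (orderOf (s * t) : ℤ) ∣ j - k := by
  rw [mul_left_inj, orderOf_dvd_sub_iff_zpow_eq_zpow]

lemma rho_conj (i j : ℤ) : ((s * t) ^ i * s) * ((s * t) ^ j * s) * ((s * t) ^ i * s)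
    = (s * t) ^ (2 * i - j) * s := by
  have hsz := s_zpow hs ht
  have : ((s * t) ^ i * s) * ((s * t) ^ j * s) = (s * t) ^ (i - j) := by
    rw [mul_assoc, ← mul_assoc s, hsz, mul_assoc, hs, mul_one, ← zpow_add]; congr 1
  rw [this, ← mul_assoc, ← zpow_add]; congr 2; ring

end dih

/-- combinatorial pattern, finite part -/
lemma pat1 {n : ℕ} {P : ℤ → Prop} {j : ℤ} (hj : 0 ≤ j) (hjn : j < n) (h0 : ¬ P 0)
    (hP : ∀ k, P (k + 1) ↔ ¬ (P k ↔ (n : ℤ) ∣ j - k)) (k : ℕ) (hk : k ≤ n) : P k ↔ j < k := by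
  induction k with
  | zero => simp [h0]; omega
  | succ k ih =>
    push_cast
    rw [hP, ih (by omega)]
    have : (n : ℤ) ∣ j - k ↔ j = k := by
      constructor
      · intro h
        have := Int.eq_zero_of_abs_lt_dvd h (by rw [abs_lt]; omega)
        omega
      · rintro rfl; simp
    rw [this]; omega

lemma pat2 {n : ℕ} {P : ℤ → Prop} {j : ℤ} (hj : 0 ≤ j) (hjn : j < n) (h0 : ¬ P 0)
    (hP : ∀ k, P (k + 1) ↔ ¬ (P k ↔ (n : ℤ) ∣ j - k)) (k : ℕ) (hk : k ≤ n) :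
    P (n + k) ↔ k ≤ j := by
  induction k with
  | zero =>
    have := pat1 hj hjn h0 hP n le_rfl
    simp [this]; omega
  | succ k ih =>
    push_cast
    rw [← add_assoc, hP, ih (by omega)]
    have : (n : ℤ) ∣ j - (n + k) ↔ j = k := by
      have e : j - (n + k : ℤ) = (j - k) - n := by ring
      rw [e, dvd_sub_self_right]
      constructor
      · intro h
        have := Int.eq_zero_of_abs_lt_dvd h (by rw [abs_lt]; omega)
        omega
      · rintro rfl; simp
    rw [this]; omega

lemma pat3 {P : ℤ → Prop} {j : ℤ} (h0 : ¬ P 0)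
    (hP : ∀ k, P (k + 1) ↔ ¬ (P k ↔ j = k)) (k : ℕ) :
    (P k ↔ 0 ≤ j ∧ j < k) ∧ (P (-k) ↔ -k ≤ j ∧ j < 0) := by
  induction k with
  | zero => simp [h0]
  | succ k ih =>
    push_cast
    constructor
    · rw [hP, ih.1]; omega
    · have := hP (-(k + 1))
      rw [show -((k:ℤ) + 1) + 1 = -k by ring, ih.2] at this
      by_cases h : P (-(k+1)) <;> simp only [h, true_iff, false_iff] at this ⊢ <;> omega

section
variable (cs : CoxeterSystem M W)

lemma exists_minimal_length (H : Subgroup W) (F : W → W) :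
    ∃ w : H, ∀ w' : H, cs.length (F w) ≤ cs.length (F w') := by
  obtain ⟨w, -, hw⟩ := WellFounded.has_min
    (InvImage.wf (fun w : H => cs.length (F w)) Nat.lt_wfRel.wf) Set.univ ⟨1, trivial⟩
  exact ⟨w, fun w' => not_lt.1 (hw w' trivial)⟩

/-- walls of the residue -/
def RR (p s t : W) (k : ℤ) : W := p * ((s * t) ^ k * s) * p⁻¹

variable (i j : B)

lemma dc_simple (k : ℤ) : ∃ l, dc (cs.simple i) (cs.simple j) k = cs.simple l := by
  unfold dc; split_ifs
  · exact ⟨i, rfl⟩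
  · exact ⟨j, rfl⟩

lemma RR_eq (p : W) (k : ℤ) : RR p (cs.simple i) (cs.simple j) k =
    p * da (cs.simple i) (cs.simple j) k * dc (cs.simple i) (cs.simple j) k *
      (p * da (cs.simple i) (cs.simple j) k)⁻¹ := by
  unfold RR
  rw [← da_wall (cs.simple_mul_simple_self i) (cs.simple_mul_simple_self j)]
  group

lemma RR_eq' (p : W) (k : ℤ) : RR p (cs.simple i) (cs.simple j) (k - 1) =
    p * da (cs.simple i) (cs.simple j) k * dc (cs.simple i) (cs.simple j) (k - 1) *
      (p * da (cs.simple i) (cs.simple j) k)⁻¹ := by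
  rw [RR_eq, da_pred (cs.simple_mul_simple_self i) (cs.simple_mul_simple_self j)]
  have := dc_mul (cs.simple_mul_simple_self i) (cs.simple_mul_simple_self j) (k - 1)
  generalize dc (cs.simple i) (cs.simple j) (k - 1) = c at *
  have h1 : c⁻¹ = c := inv_eq_of_mul_eq_one_left this
  simp only [mul_inv_rev, h1, mul_assoc]
  rw [← mul_assoc c c, this, one_mul]

lemma RR_refl (p : W) (k : ℤ) : cs.IsReflection (RR p (cs.simple i) (cs.simple j) k) := by
  obtain ⟨l, hl⟩ := dc_simple cs i j k
  rw [RR_eq, hl]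
  exact ⟨_, _, rfl⟩

lemma RR_inj (p : W) (k l : ℤ) : RR p (cs.simple i) (cs.simple j) k =
    RR p (cs.simple i) (cs.simple j) l ↔
    (orderOf (cs.simple i * cs.simple j) : ℤ) ∣ k - l := by
  rw [← rho_eq (cs.simple_mul_simple_self i) (cs.simple_mul_simple_self j)]
  unfold RR; simp

lemma RR_conj (p : W) (k l : ℤ) : RR p (cs.simple i) (cs.simple j) k *
    RR p (cs.simple i) (cs.simple j) l * RR p (cs.simple i) (cs.simple j) k =
    RR p (cs.simple i) (cs.simple j) (2 * k - l) := by
  unfold RR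
  rw [← rho_conj (cs.simple_mul_simple_self i) (cs.simple_mul_simple_self j)]
  group

variable {p : W} (hp : ∀ w ∈ Subgroup.closure {cs.simple i, cs.simple j},
  cs.length p ≤ cs.length (p * w))
include hp

lemma sig_zero (l : ℤ) : ¬ Sep cs (RR p (cs.simple i) (cs.simple j) l)
    (p * da (cs.simple i) (cs.simple j) 0) := by
  have := hp _ (rho_mem (cs.simple_mul_simple_self i) (cs.simple_mul_simple_self j) l)
  rw [da_zero (cs.simple_mul_simple_self i) (cs.simple_mul_simple_self j), mul_one]
  unfold Sep RR
  rw [inv_mul_cancel_right]; omega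

omit hp in
lemma sig_succ (l k : ℤ) : Sep cs (RR p (cs.simple i) (cs.simple j) l)
    (p * da (cs.simple i) (cs.simple j) (k + 1)) ↔
    ¬ (Sep cs (RR p (cs.simple i) (cs.simple j) l) (p * da (cs.simple i) (cs.simple j) k) ↔
      (orderOf (cs.simple i * cs.simple j) : ℤ) ∣ l - k) := by
  obtain ⟨m, hm⟩ := dc_simple cs i j k
  rw [← RR_inj cs i j p, RR_eq cs i j p k, hm,
    da_succ (cs.simple_mul_simple_self i) (cs.simple_mul_simple_self j), hm, ← mul_assoc,
    sep_mul_simple cs (RR_refl cs i j p l)]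

lemma sig1 {l : ℤ} (hl : 0 ≤ l) (hln : l < orderOf (cs.simple i * cs.simple j)) {k : ℤ}
    (hk : 0 ≤ k) (hkn : k ≤ orderOf (cs.simple i * cs.simple j)) :
    Sep cs (RR p (cs.simple i) (cs.simple j) l) (p * da (cs.simple i) (cs.simple j) k) ↔ l < k := by
  lift k to ℕ using hk
  exact pat1 (P := fun k => Sep cs (RR p (cs.simple i) (cs.simple j) l)
    (p * da (cs.simple i) (cs.simple j) k)) hl hln (sig_zero cs i j hp l)
    (sig_succ cs i j l) k (by omega)

lemma sig2 {l : ℤ} (hl : 0 ≤ l) (hln : l < orderOf (cs.simple i * cs.simple j)) {k : ℤ}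
    (hk : orderOf (cs.simple i * cs.simple j) ≤ k)
    (hkn : k ≤ 2 * orderOf (cs.simple i * cs.simple j)) :
    Sep cs (RR p (cs.simple i) (cs.simple j) l) (p * da (cs.simple i) (cs.simple j) k) ↔
      k - orderOf (cs.simple i * cs.simple j) ≤ l := by
  obtain ⟨m, rfl⟩ : ∃ m, k = orderOf (cs.simple i * cs.simple j) + m :=
    ⟨k - orderOf (cs.simple i * cs.simple j), by ring⟩
  have hm : 0 ≤ m := by omega
  lift m to ℕ using hm
  rw [add_sub_cancel_left]
  exact pat2 (P := fun k => Sep cs (RR p (cs.simple i) (cs.simple j) l)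
    (p * da (cs.simple i) (cs.simple j) k)) hl hln (sig_zero cs i j hp l)
    (sig_succ cs i j l) m (by omega)

lemma sig3 (h0 : orderOf (cs.simple i * cs.simple j) = 0) (k : ℤ) :
    ¬ (Sep cs (RR p (cs.simple i) (cs.simple j) (k - 1)) (p * da (cs.simple i) (cs.simple j) k) ∧
     Sep cs (RR p (cs.simple i) (cs.simple j) k) (p * da (cs.simple i) (cs.simple j) k)) := by
  have key := fun l => pat3 (P := fun k => Sep cs (RR p (cs.simple i) (cs.simple j) l)
    (p * da (cs.simple i) (cs.simple j) k)) (j := l) (sig_zero cs i j hp l)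
    (fun k => by
      have := sig_succ cs i j (p := p) l k
      rwa [h0, Nat.cast_zero, zero_dvd_iff, sub_eq_zero] at this)
  obtain ⟨m, rfl | rfl⟩ := Int.eq_nat_or_neg k
  · rw [(key _ m).1, (key _ m).1]; omega
  · rw [(key _ m).2, (key _ m).2]; omega

lemma sig_any (f : W) : ∃ k : ℤ, (0 < orderOf (cs.simple i * cs.simple j) → 0 ≤ k ∧
    k < 2 * orderOf (cs.simple i * cs.simple j)) ∧
    ∀ l, Sep cs (RR p (cs.simple i) (cs.simple j) l) f ↔
      Sep cs (RR p (cs.simple i) (cs.simple j) l) (p * da (cs.simple i) (cs.simple j) k) := by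
  have hs := cs.simple_mul_simple_self i
  have ht := cs.simple_mul_simple_self j
  obtain ⟨w, hw⟩ := exists_minimal_length cs (Subgroup.closure {cs.simple i, cs.simple j})
    (fun w => w⁻¹ * (p⁻¹ * f))
  obtain ⟨k, hk, hk2⟩ := exists_da' hs ht w.2
  refine ⟨k, hk2, fun l => ?_⟩
  have e : f = (p * da (cs.simple i) (cs.simple j) k) * ((w : W)⁻¹ * (p⁻¹ * f)) := by
    rw [hk]; group
  have hr := RR_refl cs i j p l
  conv_lhs => rw [e]
  rw [sep_mul cs hr]
  have : ¬ Sep cs ((p * da (cs.simple i) (cs.simple j) k)⁻¹ * RR p (cs.simple i) (cs.simple j) l *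
      (p * da (cs.simple i) (cs.simple j) k)) ((w : W)⁻¹ * (p⁻¹ * f)) := by
    rw [← hk]
    have h3 := hw ⟨_, mul_mem (rho_mem hs ht l) w.2⟩
    have e2 : ((p * (w : W))⁻¹ * RR p (cs.simple i) (cs.simple j) l * (p * w)) *
      ((w : W)⁻¹ * (p⁻¹ * f)) = (((cs.simple i * cs.simple j) ^ l * cs.simple i) * w)⁻¹ *
        (p⁻¹ * f) := by
      have hr2 : ((cs.simple i * cs.simple j) ^ l * cs.simple i)⁻¹ =
        ((cs.simple i * cs.simple j) ^ l * cs.simple i) := by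
        apply inv_eq_of_mul_eq_one_left
        rw [mul_assoc, ← mul_assoc (cs.simple i), s_zpow hs ht, mul_assoc _ (cs.simple i), hs,
          mul_one, ← zpow_add]; simp
      rw [mul_inv_rev (_ * cs.simple i) (w : W), hr2]
      unfold RR; group
    unfold Sep
    rw [e2]
    simp only at h3
    omega
  tauto

lemma between {f : W} {a b c : ℤ} (ha : 0 ≤ a) (hab : a < b) (hbc : b < c)
    (hc : c < orderOf (cs.simple i * cs.simple j))
    (h : Sep cs (RR p (cs.simple i) (cs.simple j) b) f) :
    Sep cs (RR p (cs.simple i) (cs.simple j) a) f ∨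
    Sep cs (RR p (cs.simple i) (cs.simple j) c) f := by
  obtain ⟨k, hk, hk2⟩ := sig_any cs i j hp f
  obtain ⟨hk0, hk1⟩ := hk (by omega)
  rw [hk2] at h ⊢
  rw [hk2]
  by_cases hkn : k ≤ orderOf (cs.simple i * cs.simple j)
  · rw [sig1 cs i j hp (by omega) (by omega) hk0 hkn] at h ⊢
    left; omega
  · rw [sig2 cs i j hp (by omega) (by omega) (by omega) (by omega)] at h
    rw [sig2 cs i j hp (l := c) (by omega) (by omega) (by omega) (by omega)]
    right; omega

lemma between_adj {f : W} {a b c : ℤ} (ha : 0 ≤ a) (hab : a < b) (hbc : b < c)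
    (hc : c < orderOf (cs.simple i * cs.simple j))
    (h : AdjWall cs f (RR p (cs.simple i) (cs.simple j) b)) :
    Sep cs (RR p (cs.simple i) (cs.simple j) a) f ∨
    Sep cs (RR p (cs.simple i) (cs.simple j) c) f := by
  by_cases hb : Sep cs (RR p (cs.simple i) (cs.simple j) b) f
  · exact between cs i j hp ha hab hbc hc hb
  · obtain ⟨m, hm⟩ := h
    have e : RR p (cs.simple i) (cs.simple j) b = f * cs.simple m * f⁻¹ := by rw [← hm]; group
    have ne : ∀ x y : ℤ, 0 ≤ x → x < y → y < orderOf (cs.simple i * cs.simple j) →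
        RR p (cs.simple i) (cs.simple j) x ≠ RR p (cs.simple i) (cs.simple j) y := by
      intro x y h1 h2 h3 h4
      rw [RR_inj] at h4
      have := Int.eq_zero_of_abs_lt_dvd h4 (by rw [abs_lt]; omega)
      omega
    have n1 := ne a b ha hab (by omega)
    have n2 := (ne b c (by omega) hbc hc).symm
    have hb' : Sep cs (RR p (cs.simple i) (cs.simple j) b) (f * cs.simple m) := by
      rw [sep_mul_simple cs (RR_refl cs i j p b)]; tauto
    have := between cs i j hp ha hab hbc hc hb'
    rw [sep_mul_simple cs (RR_refl cs i j p _), sep_mul_simple cs (RR_refl cs i j p _), ← e] at this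
    tauto

lemma all_nonelem (h0 : ¬ IsElementary cs (RR p (cs.simple i) (cs.simple j) 0))
    (h1 : ¬ IsElementary cs (RR p (cs.simple i) (cs.simple j)
      (orderOf (cs.simple i * cs.simple j) - 1))) (d : ℕ) :
    ∀ l : ℤ, 0 ≤ l → l < orderOf (cs.simple i * cs.simple j) →
      (l ≤ d ∨ orderOf (cs.simple i * cs.simple j) - 1 - l ≤ d) →
      ¬ IsElementary cs (RR p (cs.simple i) (cs.simple j) l) := by
  have per : ∀ l : ℤ, RR p (cs.simple i) (cs.simple j) (l + orderOf (cs.simple i * cs.simple j))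
      = RR p (cs.simple i) (cs.simple j) l := fun l => by rw [RR_inj]; simp
  induction d with
  | zero =>
    rintro l hl hln (h | h)
    · rwa [show l = 0 by simp at h; omega]
    · rwa [show l = orderOf (cs.simple i * cs.simple j) - 1 by simp at h; omega]
  | succ d ih =>
    intro l hl hln h
    by_cases hd : l ≤ d ∨ orderOf (cs.simple i * cs.simple j) - 1 - l ≤ d
    · exact ih l hl hln hd
    push Not at hd
    push_cast at h
    by_cases h2 : 2 * l < orderOf (cs.simple i * cs.simple j)
    · have hr := ih (orderOf (cs.simple i * cs.simple j) - l) (by omega) (by omega) (by omega)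
      have hc := RR_conj cs i j p 0 (orderOf (cs.simple i * cs.simple j) - l)
      rw [← per (2 * 0 - _), show 2 * 0 - ((orderOf (cs.simple i * cs.simple j) : ℤ) - l) +
        orderOf (cs.simple i * cs.simple j) = l by ring] at hc
      rw [← hc]
      refine lemU cs (RR_refl ..) (RR_refl ..) hr fun f hf => ?_
      rw [hc] at hf
      exact between_adj cs i j hp le_rfl (by omega) (by omega) (by omega) hf
    · have hr := ih (orderOf (cs.simple i * cs.simple j) - 2 - l) (by omega) (by omega) (by omega)
      have hc := RR_conj cs i j p (orderOf (cs.simple i * cs.simple j) - 1)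
        (orderOf (cs.simple i * cs.simple j) - 2 - l)
      rw [show 2 * ((orderOf (cs.simple i * cs.simple j) : ℤ) - 1) -
        (orderOf (cs.simple i * cs.simple j) - 2 - l) =
        l + orderOf (cs.simple i * cs.simple j) by ring, per] at hc
      rw [← hc]
      refine lemU cs (RR_refl ..) (RR_refl ..) hr fun f hf => ?_
      rw [hc] at hf
      exact (between_adj cs i j hp (by omega) (by omega) (by omega) (by omega) hf).symm

end

section
variable (cs : CoxeterSystem M W)

/-- a Shi step that decreases the length -/
def Down (g h : W) : Prop :=
  ∃ i : B, h = g * cs.simple i ∧ cs.length h < cs.length g ∧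
    ¬ IsElementary cs (g * cs.simple i * g⁻¹)

lemma confl {g : W} {i j : B} (h1 : Down cs g (g * cs.simple i))
    (h2 : Down cs g (g * cs.simple j)) :
    ∃ p, Relation.ReflTransGen (Down cs) (g * cs.simple i) p ∧
      Relation.ReflTransGen (Down cs) (g * cs.simple j) p := by
  have hs := cs.simple_mul_simple_self i
  have ht := cs.simple_mul_simple_self j
  obtain ⟨w, hw⟩ := exists_minimal_length cs (Subgroup.closure {cs.simple i, cs.simple j})
    (fun w => g * w)
  obtain ⟨k, hk, hk2⟩ := exists_da' hs ht (inv_mem w.2)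
  have hp : ∀ w' ∈ Subgroup.closure {cs.simple i, cs.simple j},
      cs.length (g * w) ≤ cs.length ((g * w) * w') := by
    intro w' hw'
    rw [mul_assoc]
    exact hw ⟨_, mul_mem w.2 hw'⟩
  have hg : g = (g * w) * da (cs.simple i) (cs.simple j) k := by rw [← hk]; group
  generalize g * (w : W) = p at *
  subst hg
  clear hw hk w
  have hD : ∀ {c c'} , Down cs c (c * c') → cs.length (c * c') < cs.length c ∧
      ¬ IsElementary cs (c * c' * c⁻¹) := by
    rintro c c' ⟨l, hl, h⟩
    rw [mul_right_inj] at hl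
    rw [hl] at h ⊢; exact h
  have hkk : ∃ q, Relation.ReflTransGen (Down cs)
      (p * da (cs.simple i) (cs.simple j) k * dc (cs.simple i) (cs.simple j) (k - 1)) q ∧
      Relation.ReflTransGen (Down cs)
      (p * da (cs.simple i) (cs.simple j) k * dc (cs.simple i) (cs.simple j) k) q := by
    have a1 : Down cs (p * da (cs.simple i) (cs.simple j) k)
      (p * da (cs.simple i) (cs.simple j) k * dc (cs.simple i) (cs.simple j) (k - 1)) := by
      rcases dc_pred hs ht k with ⟨h, h'⟩ | ⟨h, h'⟩ <;> rw [h'] <;> assumption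
    have a2 : Down cs (p * da (cs.simple i) (cs.simple j) k)
      (p * da (cs.simple i) (cs.simple j) k * dc (cs.simple i) (cs.simple j) k) := by
      rcases dc_pred hs ht k with ⟨h, h'⟩ | ⟨h, h'⟩ <;> rw [h] <;> assumption
    obtain ⟨b1, b2⟩ := hD a1
    obtain ⟨b3, b4⟩ := hD a2
    rw [← RR_eq'] at b2
    rw [← RR_eq] at b4
    have c1 : Sep cs (RR p (cs.simple i) (cs.simple j) (k - 1))
      (p * da (cs.simple i) (cs.simple j) k) := by
      unfold Sep; rwa [RR_eq', inv_mul_cancel_right]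
    have c2 : Sep cs (RR p (cs.simple i) (cs.simple j) k)
      (p * da (cs.simple i) (cs.simple j) k) := by
      unfold Sep; rwa [RR_eq, inv_mul_cancel_right]
    rw [mul_assoc p, mul_assoc p, ← da_pred hs ht, ← da_succ hs ht]
    have per : ∀ l : ℤ, RR p (cs.simple i) (cs.simple j) (l + orderOf (cs.simple i * cs.simple j))
      = RR p (cs.simple i) (cs.simple j) l := fun l => by rw [RR_inj]; simp
    have hn : 0 < orderOf (cs.simple i * cs.simple j) := by
      by_contra hn
      exact sig3 cs i j hp (by omega) k ⟨c1, c2⟩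
    obtain ⟨hk0, hk1⟩ := hk2 hn
    have hkn : k = orderOf (cs.simple i * cs.simple j) := by
      rcases lt_trichotomy k (orderOf (cs.simple i * cs.simple j)) with h | h | h
      · rw [sig1 cs i j hp hk0 h hk0 h.le] at c2; omega
      · exact h
      · rw [← sub_add_cancel (k - 1) (orderOf (cs.simple i * cs.simple j) : ℤ), per,
          sig2 cs i j hp (by omega) (by omega) (by omega) (by omega)] at c1
        omega
    subst hkn
    have hz := per 0
    rw [zero_add] at hz
    rw [hz] at b4
    have all : ∀ l : ℤ, 0 ≤ l → l < orderOf (cs.simple i * cs.simple j) →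
      ¬ IsElementary cs (RR p (cs.simple i) (cs.simple j) l) := fun l hl hl2 =>
      all_nonelem cs i j hp b4 b2 (l.toNat) l hl hl2 (by omega)
    refine ⟨p, ?_, ?_⟩
    · have : ∀ m : ℕ, m ≤ orderOf (cs.simple i * cs.simple j) → Relation.ReflTransGen (Down cs)
          (p * da (cs.simple i) (cs.simple j) m) p := by
        intro m
        induction m with
        | zero => intro _; rw [Nat.cast_zero, da_zero hs ht, mul_one]
        | succ m ih =>
          intro hm
          refine Relation.ReflTransGen.head ?_ (ih (by omega))
          obtain ⟨l, hl⟩ := dc_simple cs i j m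
          have e1 := da_pred hs ht ((m + 1 : ℕ) : ℤ)
          have e2 := RR_eq' cs i j p ((m + 1 : ℕ) : ℤ)
          have e3 := sig1 cs i j hp (l := m) (k := (m + 1 : ℕ)) (by omega) (by omega) (by omega)
            (by omega)
          rw [show ((m + 1 : ℕ) : ℤ) - 1 = m by push_cast; ring, hl] at e1 e2
          refine ⟨l, by rw [e1, mul_assoc], ?_, ?_⟩
          · have := e3.2 (by omega)
            unfold Sep at this
            rwa [e2, inv_mul_cancel_right, mul_assoc, ← e1] at this
          · rw [← e2]; exact all m (by omega) (by omega)
      have h := this (orderOf (cs.simple i * cs.simple j) - 1) (by omega)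
      rwa [Nat.cast_sub (by omega), Nat.cast_one] at h
    · have : ∀ m : ℕ, m ≤ orderOf (cs.simple i * cs.simple j) → Relation.ReflTransGen (Down cs)
          (p * da (cs.simple i) (cs.simple j) (2 * orderOf (cs.simple i * cs.simple j) - m)) p := by
        intro m
        induction m with
        | zero =>
          intro _
          have := da_period hs ht 0 1
          rw [zero_add, mul_one, da_zero hs ht] at this
          rw [Nat.cast_zero, sub_zero, this, mul_one]
        | succ m ih =>
          intro hm
          refine Relation.ReflTransGen.head ?_ (ih (by omega))
          set k : ℤ := 2 * orderOf (cs.simple i * cs.simple j) - (m + 1 : ℕ) with hk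
          rw [show 2 * (orderOf (cs.simple i * cs.simple j) : ℤ) - m = k + 1 by
            rw [hk]; push_cast; ring]
          obtain ⟨l, hl⟩ := dc_simple cs i j k
          have e1 := da_succ hs ht k
          have e2 := RR_eq cs i j p k
          have e3 := sig2 cs i j hp (l := k - orderOf (cs.simple i * cs.simple j)) (k := k)
            (by omega) (by omega) (by omega) (by omega)
          have e4 := per (k - orderOf (cs.simple i * cs.simple j))
          rw [sub_add_cancel] at e4
          rw [hl] at e1 e2
          refine ⟨l, by rw [e1, mul_assoc], ?_, ?_⟩
          · have := e3.2 le_rfl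
            unfold Sep at this
            rwa [← e4, e2, inv_mul_cancel_right, mul_assoc, ← e1] at this
          · rw [← e2, e4]; exact all _ (by omega) (by omega)
      have h := this (orderOf (cs.simple i * cs.simple j) - 1) (by omega)
      rw [Nat.cast_sub (by omega), Nat.cast_one] at h
      convert h using 3
      ring
  obtain ⟨q, q1, q2⟩ := hkk
  rcases dc_pred hs ht k with ⟨h, h'⟩ | ⟨h, h'⟩ <;> rw [h'] at q1 <;> rw [h] at q2
  · exact ⟨q, q2, q1⟩
  · exact ⟨q, q1, q2⟩

lemma unique_nf (n : ℕ) : ∀ g : W, cs.length g ≤ n →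
    ∃ p, Relation.ReflTransGen (Down cs) g p ∧
      ∀ h, Relation.ReflTransGen (Down cs) g h → Relation.ReflTransGen (Down cs) h p := by
  induction n with
  | zero =>
    intro g hg
    refine ⟨g, .refl, fun h hh => ?_⟩
    rcases Relation.ReflTransGen.cases_head hh with rfl | ⟨c, ⟨i, h1, h2, h3⟩, -⟩
    · exact .refl
    · omega
  | succ n ih =>
    intro g hg
    by_cases hc : ∃ c, Down cs g c
    · obtain ⟨c, hc⟩ := hc
      have hlt : ∀ {c}, Down cs g c → cs.length c < cs.length g := fun ⟨i, h1, h2, h3⟩ => h2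
      obtain ⟨p, hp, hp2⟩ := ih c (by have := hlt hc; omega)
      refine ⟨p, hp.head hc, fun h hh => ?_⟩
      rcases Relation.ReflTransGen.cases_head hh with rfl | ⟨d, hd, hdh⟩
      · exact hp.head hc
      · have : ∃ q, Relation.ReflTransGen (Down cs) c q ∧ Relation.ReflTransGen (Down cs) d q := by
          obtain ⟨i, rfl, hi⟩ := id hc
          obtain ⟨j, rfl, hj⟩ := id hd
          exact confl cs hc hd
        obtain ⟨q, q1, q2⟩ := this
        obtain ⟨p', hp', hp2'⟩ := ih d (by have := hlt hd; omega)
        have r1 := hp2 q q1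
        have r2 := hp2' p (q2.trans r1)
        exact (hp2' h hdh).trans (hp2 p' (hp.trans r2))
    · refine ⟨g, .refl, fun h hh => ?_⟩
      rcases Relation.ReflTransGen.cases_head hh with rfl | ⟨c, h', -⟩
      · exact .refl
      · exact absurd ⟨c, h'⟩ hc

lemma weakLe_of_down {h p : W} (hd : Relation.ReflTransGen (Down cs) h p) : WeakLe cs p h := by
  unfold WeakLe
  induction hd using Relation.ReflTransGen.head_induction_on with
  | refl => simp
  | @head a b hab _ ih =>
    obtain ⟨i, rfl, h2, -⟩ := hab
    have e : p⁻¹ * a = p⁻¹ * (a * cs.simple i) * cs.simple i := by simp [mul_assoc]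
    have h4 := cs.length_mul_le p (p⁻¹ * a)
    have h5 := cs.length_mul_le (p⁻¹ * (a * cs.simple i)) (cs.simple i)
    rw [← e, cs.length_simple] at h5
    rw [mul_inv_cancel_left] at h4
    omega

lemma down_shi {g h : W} (hd : Relation.ReflTransGen (Down cs) g h) : SameShiPart cs g h :=
  Relation.ReflTransGen.mono (r := Down cs) (p := ShiStep cs)
    (fun _ _ ⟨i, h1, _, h3⟩ => ⟨i, h1, h3⟩) _ _ hd

lemma shi_down {g h : W} (hd : ShiStep cs g h) : Down cs g h ∨ Down cs h g := by
  obtain ⟨i, rfl, h⟩ := hd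
  rcases cs.length_mul_simple g i with h1 | h1
  · right
    refine ⟨i, by simp, by omega, ?_⟩
    convert h using 2
    simp [mul_assoc]
  · left
    exact ⟨i, rfl, by omega, h⟩

end

end ShiAux

/-- Every Shi part of `W` has a smallest element with respect to the weak order. -/
theorem shi_part_has_smallest [Finite B] (cs : CoxeterSystem M W) (g : W) :
    ∃ p : W, SameShiPart cs g p ∧
      ∀ h : W, SameShiPart cs g h → WeakLe cs p h := by
  obtain ⟨p, hp, hp2⟩ := ShiAux.unique_nf cs _ g le_rfl
  refine ⟨p, ShiAux.down_shi cs hp, fun h hh => ShiAux.weakLe_of_down cs ?_⟩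
  induction hh with
  | refl => exact hp
  | @tail b c _ hs ih =>
    rcases ShiAux.shi_down cs hs with h1 | h1
    · obtain ⟨q, hq, hq2⟩ := ShiAux.unique_nf cs _ b le_rfl
      have hpq := hq2 p ih
      exact (hq2 c (.single h1)).trans (hp2 q (hp.trans hpq))
    · exact ih.head h1
end

section
/- The set M is a Garside shadow, i.e.: S ⊆ M; whenever h ∈ M and g ⪯ h, the element g⁻¹h belongs to M; and whenever g, g' ∈ M and the join of g and g' exists, the join belongs to M. -/
/-!
Let `(W,S)` be a Coxeter system, given by a Coxeter matrix `M : CoxeterMatrix B`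
and `cs : CoxeterSystem M W`; the set `S` of simple reflections is the range of
`cs.simple`, and `S` is finite since `B` is finite.
-/

variable {B W : Type*} [Group W] {M : CoxeterMatrix B}

/-- `j` is the join of `g` and `g'` with respect to the weak order. -/
def IsJoin (cs : CoxeterSystem M W) (g g' j : W) : Prop :=
  WeakLe cs g j ∧ WeakLe cs g' j ∧
    ∀ f : W, WeakLe cs g f → WeakLe cs g' f → WeakLe cs j f

set_option linter.all false
namespace Gar
open Real

section geom
variable {B : Type*} [Fintype B] [DecidableEq B] (M : CoxeterMatrix B)

noncomputable def bf : LinearMap.BilinForm ℝ (B → ℝ) :=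
  Matrix.toBilin' (Matrix.of fun i j => - Real.cos (π / (M i j : ℝ)))

def al (i : B) : B → ℝ := Pi.single i 1

lemma bf_al (i j : B) : bf M (al i) (al j) = - Real.cos (π / (M i j : ℝ)) := by
  simp [bf, al]

lemma bf_self (i : B) : bf M (al i) (al i) = 1 := by
  simp [bf_al, M.diagonal]

lemma bf_symm (x y : B → ℝ) : bf M x y = bf M y x := by
  simp only [bf, Matrix.toBilin'_apply]
  rw [Finset.sum_comm]
  refine Finset.sum_congr rfl fun i _ => Finset.sum_congr rfl fun j _ => ?_
  simp only [Matrix.of_apply, M.symmetric i j]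
  ring

noncomputable def rf (x : B → ℝ) : Module.End ℝ (B → ℝ) where
  toFun v := v - (2 * bf M v x) • x
  map_add' u v := by simp only [map_add, LinearMap.add_apply]; module
  map_smul' c v := by simp only [map_smul, LinearMap.smul_apply, smul_eq_mul, RingHom.id_apply]; module

lemma rf_apply (x v : B → ℝ) : rf M x v = v - (2 * bf M v x) • x := rfl

lemma rf_self {x : B → ℝ} (h : bf M x x = 1) : rf M x x = - x := by
  rw [rf_apply, h]; module

lemma rf_rf {x : B → ℝ} (h : bf M x x = 1) (v : B → ℝ) : rf M x (rf M x v) = v := by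
  simp only [rf_apply, map_sub, map_smul, LinearMap.sub_apply, LinearMap.smul_apply, h, smul_eq_mul]
  module

lemma rf_bf {x : B → ℝ} (h : bf M x x = 1) (u v : B → ℝ) :
    bf M (rf M x u) (rf M x v) = bf M u v := by
  simp only [rf_apply, map_sub, map_smul, LinearMap.sub_apply, LinearMap.smul_apply, h, smul_eq_mul,
    bf_symm M x v]
  ring

lemma rot_aux {V : Type*} [AddCommGroup V] [Module ℝ V] (T : Module.End ℝ V) (a b : V) (mu : ℝ)
    (h : ∀ p : ℝ, T (Real.sin (p + mu) • a + Real.sin p • b)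
      = Real.sin (p + 2 * mu + mu) • a + Real.sin (p + 2 * mu) • b) (n : ℕ) (p : ℝ) :
    (T ^ n) (Real.sin (p + mu) • a + Real.sin p • b)
      = Real.sin (p + 2 * n * mu + mu) • a + Real.sin (p + 2 * n * mu) • b := by
  induction n generalizing p with
  | zero => simp
  | succ n ih =>
    rw [pow_succ, Module.End.mul_apply, h, ih]
    push_cast
    congr 3 <;> ring_nf

lemma liftable : M.IsLiftable (fun i => rf M (al i)) := by
  intro i j
  by_cases hij : i = j
  · subst hij
    simp only [M.diagonal, pow_one]
    refine LinearMap.ext fun v => ?_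
    simp [rf_rf M (bf_self M i)]
  by_cases h0 : M i j = 0
  · simp [h0]
  have h1 : M i j ≠ 1 := M.off_diagonal i j hij
  have h2 : 2 ≤ M i j := by omega
  set mu := π / (M i j : ℝ) with hmu
  have hM : (0:ℝ) < M i j := by positivity
  have hmupos : 0 < mu := by positivity
  have hmupi : mu < π := by
    rw [hmu, div_lt_iff₀ hM]
    have : (2:ℝ) ≤ M i j := by exact_mod_cast h2
    nlinarith [Real.pi_pos]
  have hs : 0 < Real.sin mu := Real.sin_pos_of_pos_of_lt_pi hmupos hmupi
  have hab : bf M (al i) (al j) = - Real.cos mu := bf_al M i j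
  have hba : bf M (al j) (al i) = - Real.cos mu := by rw [bf_symm, hab]
  have haa := bf_self M i
  have hbb := bf_self M j
  have key : ∀ p : ℝ, (rf M (al i) * rf M (al j)) (Real.sin (p + mu) • al i + Real.sin p • al j)
      = Real.sin (p + 2 * mu + mu) • al i + Real.sin (p + 2 * mu) • al j := by
    intro p
    have e1 : Real.sin (p + 2 * mu) = 2 * Real.cos mu * Real.sin (p + mu) - Real.sin p := by
      have := Real.sin_add (p+mu) mu
      have h3 := Real.sin_sub (p+mu) mu
      rw [show p + 2 * mu = p + mu + mu by ring, this]
      rw [show p + mu - mu = p by ring] at h3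
      rw [h3]; ring
    have e2 : Real.sin (p + 2 * mu + mu) = 2 * Real.cos mu * Real.sin (p + 2 * mu) - Real.sin (p + mu) := by
      have := Real.sin_add (p+2*mu) mu
      have h3 := Real.sin_sub (p+2*mu) mu
      rw [this]
      rw [show p + 2 * mu - mu = p + mu by ring] at h3
      rw [h3]; ring
    rw [e2, e1]
    simp only [Module.End.mul_apply, rf_apply, map_sub, map_add, map_smul, LinearMap.sub_apply,
      LinearMap.add_apply, LinearMap.smul_apply, smul_eq_mul, hab, hba, haa, hbb]
    module
  have hpi : 2 * (M i j : ℝ) * mu = 2 * π := by rw [hmu]; field_simp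
  have key2 : ∀ p : ℝ, ((rf M (al i) * rf M (al j)) ^ (M i j)) (Real.sin (p + mu) • al i + Real.sin p • al j)
      = Real.sin (p + mu) • al i + Real.sin p • al j := by
    intro p
    rw [rot_aux _ _ _ _ key, hpi, show p + 2 * π + mu = p + mu + 2 * π by ring, Real.sin_add_two_pi, Real.sin_add_two_pi]
  set T := (rf M (al i) * rf M (al j)) ^ (M i j) with hT
  have ha : T (al i) = al i := by
    have := key2 0
    simp only [zero_add, Real.sin_zero, zero_smul, add_zero, map_smul] at this
    exact (smul_right_injective _ hs.ne') this
  have hb : T (al j) = al j := by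
    have := key2 (-mu)
    simp only [neg_add_cancel, Real.sin_zero, zero_smul, zero_add, map_smul, Real.sin_neg, neg_smul, map_neg, neg_inj] at this
    exact (smul_right_injective _ hs.ne') this
  have hperp : ∀ v, bf M v (al i) = 0 → bf M v (al j) = 0 → T v = v := by
    intro v h1 h2
    have h3 : (rf M (al i) * rf M (al j)) v = v := by
      simp [Module.End.mul_apply, rf_apply, h1, h2]
    rw [hT]
    generalize M i j = n
    induction n with
    | zero => simp
    | succ n ih => rw [pow_succ, Module.End.mul_apply, h3, ih]
  refine LinearMap.ext fun x => ?_
  have hc : 1 - Real.cos mu ^ 2 ≠ 0 := by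
    have := Real.sin_sq_add_cos_sq mu
    have h3 : 0 < Real.sin mu ^ 2 := by positivity
    intro h; linarith
  set X := bf M x (al i) with hX
  set Y := bf M x (al j) with hY
  set c := Real.cos mu with hcdef
  set p := (X + c * Y) / (1 - c^2) with hp
  set q := (Y + c * X) / (1 - c^2) with hq
  have e : x = (x - p • al i - q • al j) + p • al i + q • al j := by module
  have := hperp (x - p • al i - q • al j) (by
    simp only [map_sub, map_smul, LinearMap.sub_apply, LinearMap.smul_apply, smul_eq_mul, haa, hba, ← hX]
    rw [hp, hq]; field_simp; ring) (by
    simp only [map_sub, map_smul, LinearMap.sub_apply, LinearMap.smul_apply, smul_eq_mul, hbb, hab, ← hY]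
    rw [hp, hq]; field_simp; ring)
  rw [Module.End.one_apply]
  conv_lhs => rw [e]
  rw [map_add, map_add, map_smul, map_smul, ha, hb, this]
  exact e.symm

end geom
end Gar

namespace Gar
open Real

section geom
variable {B : Type*} [Fintype B] [DecidableEq B] {M : CoxeterMatrix B}
  {W : Type*} [Group W] (cs : CoxeterSystem M W)

noncomputable def rho : W →* Module.End ℝ (B → ℝ) := cs.lift ⟨_, liftable M⟩

lemma rho_simple (i : B) : rho cs (cs.simple i) = rf M (al i) := by
  simp [rho]

lemma rho_bf (w : W) (u v : B → ℝ) : bf M (rho cs w u) (rho cs w v) = bf M u v := by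
  induction w using cs.simple_induction_left generalizing u v with
  | one => simp
  | mul_simple_left w i ih =>
    rw [map_mul, rho_simple, Module.End.mul_apply, Module.End.mul_apply, rf_bf M (bf_self M i), ih]

@[simp] lemma rho_mul (w w' : W) (v : B → ℝ) : rho cs (w * w') v = rho cs w (rho cs w' v) := by
  rw [map_mul, Module.End.mul_apply]

@[simp] lemma rho_one (v : B → ℝ) : rho cs 1 v = v := by simp

lemma rho_inv (w : W) (v : B → ℝ) : rho cs w⁻¹ (rho cs w v) = v := by
  rw [← rho_mul]; simp
lemma rho_inv' (w : W) (v : B → ℝ) : rho cs w (rho cs w⁻¹ v) = v := by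
  rw [← rho_mul]; simp

def alt (i j : B) : ℕ → W
  | 0 => 1
  | n+1 => alt j i n * cs.simple j

lemma alt_eq (i j : B) (n : ℕ) : alt cs i j n = cs.wordProd (CoxeterSystem.alternatingWord i j n) := by
  induction n generalizing i j with
  | zero => simp [alt, CoxeterSystem.alternatingWord]
  | succ n ih => rw [alt, CoxeterSystem.alternatingWord_succ, ih, List.concat_eq_append, cs.wordProd_append]; simp

noncomputable def U (c : ℝ) : ℕ → ℝ
  | 0 => 0
  | 1 => 1
  | n+2 => 2 * c * U c (n+1) - U c n

lemma U_sin (mu : ℝ) (n : ℕ) : U (Real.cos mu) n * Real.sin mu = Real.sin (n * mu) := by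
  induction n using Nat.twoStepInduction with
  | zero => simp [U]
  | one => simp [U]
  | more n h1 h2 =>
    have a := Real.sin_add ((n+1:ℕ)*mu) mu
    have b := Real.sin_sub ((n+1:ℕ)*mu) mu
    rw [show ((n+1:ℕ):ℝ)*mu - mu = n * mu by push_cast; ring] at b
    rw [show ((n+2:ℕ):ℝ) * mu = (n+1:ℕ)*mu + mu by push_cast; ring, a, U, sub_mul, h1, mul_assoc, h2, b]
    ring

lemma U_one (n : ℕ) : U 1 n = n := by
  induction n using Nat.twoStepInduction with
  | zero => simp [U]
  | one => simp [U]
  | more n h1 h2 => rw [U, h1, h2]; push_cast; ring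

lemma U_nonneg {m n : ℕ} (h : m = 0 ∨ n ≤ m) (hm : m ≠ 1) : 0 ≤ U (Real.cos (π / m)) n := by
  by_cases h0 : m = 0
  · subst h0; simp [U_one]
  have h2 : 2 ≤ m := by omega
  have hn : n ≤ m := by tauto
  have hM : (0:ℝ) < m := by positivity
  have hs : 0 < Real.sin (π / m) := by
    apply Real.sin_pos_of_pos_of_lt_pi (by positivity)
    rw [div_lt_iff₀ hM]
    have : (2:ℝ) ≤ m := by exact_mod_cast h2
    nlinarith [Real.pi_pos]
  have := U_sin (π / m) n
  have h3 : 0 ≤ Real.sin (n * (π / m)) := by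
    apply Real.sin_nonneg_of_nonneg_of_le_pi (by positivity)
    have : (n:ℝ) ≤ m := by exact_mod_cast hn
    rw [← mul_div_assoc, div_le_iff₀ hM]
    nlinarith [Real.pi_pos]
  by_contra h4
  push Not at h4
  nlinarith

lemma alt_al (i j : B) (n : ℕ) : rho cs (alt cs i j n) (al i) =
    if Even n then U (Real.cos (π / M i j)) (n+1) • al i + U (Real.cos (π / M i j)) n • al j
    else U (Real.cos (π / M i j)) (n+1) • al j + U (Real.cos (π / M i j)) n • al i := by
  obtain ⟨c, hc⟩ : ∃ c, c = Real.cos (π / M i j) := ⟨_, rfl⟩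
  rw [← hc]
  have hij : bf M (al i) (al j) = - c := by rw [hc]; exact bf_al M i j
  have hji : bf M (al j) (al i) = - c := by rw [bf_symm, hij]
  induction n using Nat.twoStepInduction generalizing i j with
  | zero => simp [alt, U]
  | one => simp [alt, U, rho_simple, rf_apply, hij]; module
  | more n h1 h2 =>
    have hc' : c = Real.cos (π / M j i) := by rw [M.symmetric j i, hc]
    have e : rho cs (alt cs i j (n+2)) (al i) =
      (2 * c) • rho cs (alt cs j i (n+1)) (al j) - rho cs (alt cs i j n) (al i) := by
      rw [alt, rho_mul, rho_simple, rf_apply, hij, map_sub, map_smul, alt, rho_mul, rho_mul, rho_simple,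
        rf_self M (bf_self M i), map_neg]
      module
    rw [e, h2 j i hc' hji hij, h1 i j hc hij hji]
    by_cases hn : Even n
    · have : ¬ Even (n+1) := by rw [Nat.even_add_one]; simpa
      have h' : Even (n+2) := by rw [Nat.even_add]; simpa
      rw [if_neg this, if_pos hn, if_pos h', U.eq_3 c (n+1)]
      rw [show U c (n+1+1) = 2*c*U c (n+1) - U c n from rfl]
      module
    · have : Even (n+1) := by rw [Nat.even_add_one]; exact hn
      have h' : ¬ Even (n+2) := by rw [Nat.even_add]; simpa using hn
      rw [if_pos this, if_neg hn, if_neg h', U.eq_3 c (n+1)]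
      rw [show U c (n+1+1) = 2*c*U c (n+1) - U c n from rfl]
      module

lemma exists_alt (w : W) (i j : B) (hi : ¬ cs.IsRightDescent w i) :
    ∃ n v, w = v * alt cs i j n ∧ cs.length w = cs.length v + n ∧
      ¬ cs.IsRightDescent v i ∧ ¬ cs.IsRightDescent v j := by
  induction hl : cs.length w using Nat.strong_induction_on generalizing w i j with
  | _ L ih =>
  by_cases hj : cs.IsRightDescent w j
  · have h1 := (cs.isRightDescent_iff).1 hj
    have h2 : ¬ cs.IsRightDescent (w * cs.simple j) j := by
      rw [CoxeterSystem.IsRightDescent]; simp; omega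
    obtain ⟨n, v, e, hlen, hv1, hv2⟩ := ih _ (by omega) (w * cs.simple j) j i h2 rfl
    refine ⟨n+1, v, ?_, by omega, hv2, hv1⟩
    rw [alt, ← mul_assoc, ← e]; simp
  · exact ⟨0, w, by simp [alt], by simp [hl], hi, hj⟩

lemma length_alt_le (i j : B) (n : ℕ) : cs.length (alt cs i j n) ≤ n := by
  rw [alt_eq]
  simpa using cs.length_wordProd_le (CoxeterSystem.alternatingWord i j n)

lemma al_nonneg (i : B) : (0 : B → ℝ) ≤ al i := by
  rw [al]; exact Pi.single_nonneg.2 zero_le_one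

lemma alt_len_le {v : W} {i j : B} {n : ℕ} 
    (h : cs.length (v * alt cs i j n) = cs.length v + n) : M i j = 0 ∨ n ≤ M i j := by
  by_contra hh
  push Not at hh
  have := cs.not_isReduced_alternatingWord i j (m := n) hh.1 hh.2
  rw [CoxeterSystem.IsReduced] at this
  simp only [CoxeterSystem.length_alternatingWord, ← alt_eq] at this
  have h1 := length_alt_le cs i j n
  have h2 := cs.length_mul_le v (alt cs i j n)
  omega

lemma alt_len {v : W} {i j : B} {n : ℕ} 
    (h : cs.length (v * alt cs i j n) = cs.length v + n) : cs.length (alt cs i j n) = n := by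
  have h1 := length_alt_le cs i j n
  have h2 := cs.length_mul_le v (alt cs i j n)
  omega

theorem sign_pos (w : W) (i : B) (hi : ¬ cs.IsRightDescent w i) : 0 ≤ rho cs w (al i) := by
  induction hl : cs.length w using Nat.strong_induction_on generalizing w i with
  | _ L ih =>
  by_cases hw : w = 1
  · subst hw; rw [rho_one]; exact al_nonneg i
  obtain ⟨j, hj⟩ := cs.exists_rightDescent_of_ne_one hw
  obtain ⟨n, v, e, hlen, hv1, hv2⟩ := exists_alt cs w i j hi
  have hij : i ≠ j := by rintro rfl; exact hi hj
  have hn : n ≠ 0 := by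
    rintro rfl
    simp [alt] at e
    exact hv2 (e ▸ hj)
  have hn1 : cs.length (w * cs.simple i) = cs.length v + (n+1) := by
    rw [CoxeterSystem.not_isRightDescent_iff] at hi
    omega
  have e2 : w * cs.simple i = v * alt cs j i (n+1) := by
    rw [alt, e, mul_assoc]
  rw [e2] at hn1
  have hM := alt_len_le cs hn1
  rw [M.symmetric] at hM
  have hne := M.off_diagonal i j hij
  have c1 := U_nonneg hM hne
  have c2 := U_nonneg (n := n) (hM.imp id (by omega)) hne
  have p1 := ih _ (by omega) v i hv1 rfl
  have p2 := ih _ (by omega) v j hv2 rfl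
  rw [e, rho_mul, alt_al]
  split_ifs
  · rw [map_add, map_smul, map_smul]
    exact add_nonneg (smul_nonneg c1 p1) (smul_nonneg c2 p2)
  · rw [map_add, map_smul, map_smul]
    exact add_nonneg (smul_nonneg c1 p2) (smul_nonneg c2 p1)

theorem sign_neg (w : W) (i : B) (hi : cs.IsRightDescent w i) : rho cs w (al i) ≤ 0 := by
  have h2 : ¬ cs.IsRightDescent (w * cs.simple i) i := by
    rw [CoxeterSystem.IsRightDescent] at *; simp; omega
  have := sign_pos cs _ i h2
  rw [rho_mul, rho_simple, rf_self M (bf_self M i), map_neg] at this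
  simpa using this

def IsRoot (x : B → ℝ) : Prop := ∃ w i, x = rho cs w (al i)

variable {cs}

lemma IsRoot.norm {x : B → ℝ} (h : IsRoot cs x) : bf M x x = 1 := by
  obtain ⟨w, i, rfl⟩ := h
  rw [rho_bf, bf_self]

lemma IsRoot.ne {x : B → ℝ} (h : IsRoot cs x) : x ≠ 0 := by
  rintro rfl; simpa using h.norm

lemma IsRoot.sign {x : B → ℝ} (h : IsRoot cs x) : 0 ≤ x ∨ x ≤ 0 := by
  obtain ⟨w, i, rfl⟩ := h
  by_cases hi : cs.IsRightDescent w i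
  · exact Or.inr (sign_neg cs w i hi)
  · exact Or.inl (sign_pos cs w i hi)

lemma IsRoot.not_both {x : B → ℝ} (h : IsRoot cs x) (h1 : 0 ≤ x) (h2 : x ≤ 0) : False :=
  h.ne (le_antisymm h2 h1)

lemma IsRoot.not_nonneg {x : B → ℝ} (h : IsRoot cs x) : ¬ 0 ≤ x ↔ x ≤ 0 :=
  ⟨fun h1 => h.sign.resolve_left h1, fun h1 h2 => h.not_both h2 h1⟩

lemma IsRoot.not_nonpos {x : B → ℝ} (h : IsRoot cs x) : ¬ x ≤ 0 ↔ 0 ≤ x :=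
  ⟨fun h1 => h.sign.resolve_right h1, fun h1 h2 => h.not_both h1 h2⟩

lemma isRoot_al (i : B) : IsRoot cs (al i) := ⟨1, i, by simp⟩

lemma IsRoot.rho {x : B → ℝ} (h : IsRoot cs x) (w : W) : IsRoot cs (Gar.rho cs w x) := by
  obtain ⟨v, i, rfl⟩ := h
  exact ⟨w * v, i, by simp⟩

lemma IsRoot.neg {x : B → ℝ} (h : IsRoot cs x) : IsRoot cs (-x) := by
  obtain ⟨v, i, rfl⟩ := h
  exact ⟨v * cs.simple i, i, by rw [rho_mul, rho_simple, rf_self M (bf_self M i), map_neg]⟩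

lemma rho_conj (w : W) (i : B) : Gar.rho cs (w * cs.simple i * w⁻¹) = rf M (Gar.rho cs w (al i)) := by
  refine LinearMap.ext fun v => ?_
  rw [rho_mul, rho_mul, rho_simple, rf_apply, rf_apply, map_sub, map_smul, rho_inv',
    ← rho_bf cs w (Gar.rho cs w⁻¹ v), rho_inv']

lemma IsRoot.rf {x y : B → ℝ} (h : IsRoot cs x) (hy : IsRoot cs y) : IsRoot cs (rf M x y) := by
  obtain ⟨v, i, rfl⟩ := h
  rw [← rho_conj]
  exact hy.rho _

lemma isRightDescent_iff_neg (w : W) (i : B) : cs.IsRightDescent w i ↔ rho cs w (al i) ≤ 0 := by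
  refine ⟨sign_neg cs w i, fun h => ?_⟩
  by_contra h2
  exact ((isRoot_al i).rho w).not_both (sign_pos cs w i h2) h

lemma rho_inj {w w' : W} (h : rho cs w = rho cs w') : w = w' := by
  by_contra hne
  have : w⁻¹ * w' ≠ 1 := by rwa [Ne, inv_mul_eq_one]
  obtain ⟨j, hj⟩ := cs.exists_rightDescent_of_ne_one this
  rw [isRightDescent_iff_neg, rho_mul, ← h, rho_inv] at hj
  exact (isRoot_al (cs := cs) j).not_both (al_nonneg j) hj

lemma rf_neg (x : B → ℝ) : rf M (-x) = rf M x := by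
  refine LinearMap.ext fun v => ?_
  rw [rf_apply, rf_apply, map_neg]; module

lemma rf_eq {x y : B → ℝ} (hx : bf M x x = 1) (hy : bf M y y = 1) (h : rf M x = rf M y) : x = y ∨ x = - y := by
  have h1 : rf M y x = - x := by rw [← h, rf_self M hx]
  rw [rf_apply] at h1
  have h2 : x = (bf M x y) • y := by
    have : (2:ℝ) • x = (2:ℝ) • ((bf M x y) • y) := by
      rw [smul_smul]
      have := sub_eq_iff_eq_add.1 h1
      have h3 : (2:ℝ) • x = x + x := two_smul _ _
      rw [h3]
      nth_rewrite 1 [this]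
      abel
    exact smul_right_injective _ two_ne_zero this
  have h3 : (bf M x y) * bf M x y = 1 := by
    have := hx
    nth_rewrite 2 [h2] at this
    rwa [map_smul, smul_eq_mul] at this
  rcases mul_self_eq_one_iff.1 h3 with h | h
  · left; rw [h2, h, one_smul]
  · right; rw [h2, h]; module

lemma refl_root {t : W} (h : cs.IsReflection t) : ∃ x, IsRoot cs x ∧ 0 ≤ x ∧ rho cs t = rf M x := by
  obtain ⟨w, i, rfl⟩ := h
  have hr := (isRoot_al (cs := cs) i).rho w
  rcases hr.sign with h | h
  · exact ⟨_, hr, h, rho_conj w i⟩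
  · exact ⟨_, hr.neg, by simpa using h, by rw [rf_neg]; exact rho_conj w i⟩

lemma root_refl {x : B → ℝ} (h : IsRoot cs x) : ∃ t, cs.IsReflection t ∧ rho cs t = rf M x := by
  obtain ⟨w, i, rfl⟩ := h
  exact ⟨_, ⟨w, i, rfl⟩, rho_conj w i⟩

lemma simple_pos {x : B → ℝ} (h : IsRoot cs x) (h0 : 0 ≤ x) {i : B} (h1 : rf M (al i) x ≤ 0) : x = al i := by
  have h2 : ∀ j, j ≠ i → x j = 0 := by
    intro j hj
    have := h1 j
    rw [rf_apply] at this
    simp [al, hj] at this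
    exact le_antisymm this (h0 j)
  have h3 : x = x i • al i := by
    ext j
    by_cases hj : j = i
    · subst hj; simp [al]
    · simp [al, hj, h2 j hj]
  have h4 := h.norm
  rw [h3, map_smul, map_smul, LinearMap.smul_apply, bf_self] at h4
  simp at h4
  have : x i = 1 := by
    have := h0 i
    simp at this
    nlinarith
  rw [h3, this, one_smul]

lemma simple_pos' {x : B → ℝ} (h : IsRoot cs x) (h0 : 0 ≤ x) {i : B} (h1 : x ≠ al i) : 0 ≤ rf M (al i) x := by
  rw [← ((isRoot_al i).rf h).not_nonpos]
  exact fun h2 => h1 (simple_pos h h0 h2)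

lemma len_of_neg (f : W) {t : W} {x : B → ℝ} (hx : IsRoot cs x) (h0 : 0 ≤ x) (ht : rho cs t = rf M x)
    (h : rho cs f⁻¹ x ≤ 0) : cs.length (t * f) < cs.length f := by
  induction hl : cs.length f using Nat.strong_induction_on generalizing f with
  | _ L ih =>
  have hf : f ≠ 1 := by rintro rfl; simp at h; exact hx.not_both h0 h
  obtain ⟨j, hj⟩ := cs.exists_rightDescent_of_ne_one hf
  have hj' := cs.isRightDescent_iff.1 hj
  obtain ⟨g, hg⟩ : ∃ g, g = f * cs.simple j := ⟨_, rfl⟩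
  have hfg : f = g * cs.simple j := by simp [hg]
  rw [← hg] at hj'
  rcases (hx.rho g⁻¹).sign with h1 | h1
  · rw [hfg, mul_inv_rev, rho_mul, CoxeterSystem.inv_simple, rho_simple] at h
    have := simple_pos (hx.rho _) h1 h
    have h2 : x = rho cs g (al j) := by rw [← this, rho_inv']
    have h3 : t = g * cs.simple j * g⁻¹ := rho_inj (cs := cs) (by rw [ht, h2, rho_conj])
    rw [h3, hfg]
    simp; omega
  · have := ih _ (by omega) g h1 rfl
    have h2 := cs.length_mul_le (t * g) (cs.simple j)
    rw [mul_assoc, ← hfg, cs.length_simple] at h2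
    omega

lemma len_iff (f : W) {t : W} {x : B → ℝ} (hx : IsRoot cs x) (h0 : 0 ≤ x) (ht : rho cs t = rf M x) :
    cs.length (t * f) < cs.length f ↔ rho cs f⁻¹ x ≤ 0 := by
  refine ⟨fun h => ?_, len_of_neg f hx h0 ht⟩
  by_contra h1
  rw [(hx.rho _).not_nonpos] at h1
  have htt : t * t = 1 := rho_inj (cs := cs) (by
    refine LinearMap.ext fun v => ?_
    rw [rho_mul, ht, rf_rf M hx.norm]; simp)
  have hti : t⁻¹ = t := inv_eq_of_mul_eq_one_left htt
  have := len_of_neg (t * f) hx h0 ht (by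
    rw [mul_inv_rev, rho_mul, hti, ht, rf_self M hx.norm, map_neg]; simpa using h1)
  rw [← mul_assoc, htt, one_mul] at this
  omega

lemma finite_inv (w : W) : {x | IsRoot cs x ∧ 0 ≤ x ∧ rho cs w x ≤ 0}.Finite := by
  induction w using cs.simple_induction_right with
  | one =>
    convert Set.finite_empty
    ext x
    simp only [Set.mem_setOf_eq, Set.mem_empty_iff_false, iff_false, rho_one]
    rintro ⟨h1, h2, h3⟩
    exact h1.not_both h2 h3
  | mul_simple_right w i ih =>
    refine ((ih.image (rf M (al i))).union (Set.finite_singleton (al i))).subset ?_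
    rintro x ⟨h1, h2, h3⟩
    by_cases h : x = al i
    · right; exact h
    · left
      refine ⟨rf M (al i) x, ⟨(isRoot_al i).rf h1, simple_pos' h1 h2 h, ?_⟩, rf_rf M (bf_self M i) x⟩
      rwa [rho_mul, rho_simple] at h3

end geom
end Gar

namespace Gar
open Real

lemma seq_contra (v : ℕ → ℝ) (c : ℝ) (hc : c < 2) (h : ∀ n, v (n+2) = c * v (n+1) - v n)
    (h0 : 0 < v 0) (hv : ∀ n, 0 ≤ v n) : False := by
  have hD : ∀ n, v (n+2) - v (n+1) ≤ v (n+1) - v n := by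
    intro n
    rw [h]; nlinarith [hv (n+1)]
  by_cases hN : ∃ N, v (N+1) - v N < 0
  · obtain ⟨N, hN⟩ := hN
    have h1 : ∀ k, v (N+k+1) - v (N+k) ≤ v (N+1) - v N := by
      intro k
      induction k with
      | zero => simp
      | succ k ih => exact (hD _).trans ih
    have h2 : ∀ k : ℕ, v (N+k) ≤ v N + k * (v (N+1) - v N) := by
      intro k
      induction k with
      | zero => simp
      | succ k ih => 
        have := h1 k
        rw [← add_assoc]; push_cast; linarith
    obtain ⟨k, hk⟩ := exists_nat_gt (v N / (v N - v (N+1)))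
    rw [div_lt_iff₀ (by linarith)] at hk
    have := h2 k
    have := hv (N+k)
    linarith
  · push Not at hN
    have h1 : ∀ n, v 0 ≤ v n := by
      intro n
      induction n with
      | zero => simp
      | succ n ih => have := hN n; linarith
    have h2 : ∀ n : ℕ, v (n+1) - v n ≤ v 1 - v 0 - n * ((2 - c) * v 0) := by
      intro n
      induction n with
      | zero => simp
      | succ n ih =>
        have := h n
        have h3 := h1 (n+1)
        push_cast
        rw [show v (n+1+1) = v (n+2) from rfl, this]
        nlinarith
    have hp : 0 < (2-c) * v 0 := by apply mul_pos <;> linarith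
    obtain ⟨k, hk⟩ := exists_nat_gt ((v 1 - v 0) / ((2-c) * v 0))
    rw [div_lt_iff₀ hp] at hk
    have := h2 k
    have := hN k
    linarith

section geom
variable {B : Type*} [Fintype B] [DecidableEq B] {M : CoxeterMatrix B}
  {W : Type*} [Group W] {cs : CoxeterSystem M W}

lemma adj_root {f r : W} {d : B → ℝ} (hd : bf M d d = 1) (hr : rho cs r = rf M d) {i : B}
    (h : f⁻¹ * r * f = cs.simple i) : rho cs f (al i) = d ∨ rho cs f (al i) = - d := by
  have h1 : r = f * cs.simple i * f⁻¹ := by rw [← h]; group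
  rw [h1, rho_conj] at hr
  exact rf_eq (by rw [rho_bf, bf_self]) hd hr

lemma sep_key {r : W} (hr : cs.IsReflection r) {k : B → ℝ} (hk : IsRoot cs k)
    (h : ∀ f, AdjWall cs f r → rho cs f⁻¹ k ≤ 0) (x : W) (h1 : 0 ≤ rho cs x⁻¹ k)
    (h2 : 0 ≤ rho cs x⁻¹ (rho cs r k)) : False := by
  induction hl : cs.length (x⁻¹ * r * x) using Nat.strong_induction_on generalizing x with
  | _ L ih =>
  by_cases ha : AdjWall cs x r
  · exact (hk.rho _).not_both h1 (h x ha)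
  obtain ⟨t, ht⟩ : ∃ t, t = x⁻¹ * r * x := ⟨_, rfl⟩
  have htr : cs.IsReflection t := by
    have := hr.conj x⁻¹
    rw [ht]; simpa using this
  rw [← ht] at hl
  obtain ⟨c, hc⟩ : ∃ c, c = rho cs x⁻¹ k := ⟨_, rfl⟩
  have hcr : IsRoot cs c := hc ▸ hk.rho _
  have h2' : rho cs x⁻¹ (rho cs r k) = rho cs t c := by
    rw [hc, ht, ← rho_mul, ← rho_mul]; congr 2; group
  rw [h2'] at h2
  rw [← hc] at h1
  obtain ⟨i, hi⟩ := cs.exists_rightDescent_of_ne_one (w := t) (by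
    rintro rfl; simpa using htr.odd_length)
  have hi' := (isRightDescent_iff_neg _ _).1 hi
  have htt : t * t = 1 := htr.mul_self
  have hti : t⁻¹ = t := inv_eq_of_mul_eq_one_left htt
  have e1 : 0 ≤ rf M (al i) c := simple_pos' hcr h1 (by
    rintro rfl; exact ((isRoot_al i).rho t).not_both h2 hi')
  have e2 : 0 ≤ rf M (al i) (rho cs t c) := simple_pos' (hcr.rho _) h2 (by
    intro e
    rw [← e, ← rho_mul, htt, rho_one] at hi'
    exact hcr.not_both h1 hi')
  have e3 : cs.length (cs.simple i * t * cs.simple i) < cs.length t := by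
    have h3 : rho cs (t * cs.simple i)⁻¹ (al i) ≤ 0 := by
      rw [mul_inv_rev, hti, CoxeterSystem.inv_simple, rho_mul, rho_simple]
      rw [← ((isRoot_al i).rf ((isRoot_al i).rho t)).not_nonneg]
      intro h4
      have h5 := simple_pos (i := i) (((isRoot_al (cs := cs) i).rho t).neg) (by simpa using hi') (by simpa using h4)
      apply ha
      refine ⟨i, ?_⟩
      rw [← ht]
      obtain ⟨d, hd1, hd2, hd3⟩ := refl_root htr
      rw [hd3, rf_apply] at h5
      apply rho_inj (cs := cs)
      rw [hd3, rho_simple]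
      have h6 : al i = (bf M (al i) d) • d := by
        have : (2:ℝ) • al i = (2:ℝ) • ((bf M (al i) d) • d) := by
          rw [smul_smul]
          have h7 : (2:ℝ) • al i = al i + al i := two_smul _ _
          rw [h7]
          nth_rewrite 2 [← h5]
          module
        exact smul_right_injective _ two_ne_zero this
      have h8 := bf_self M i
      have h9 : bf M (al i) d * bf M (al i) d = 1 := by
        nth_rewrite 2 [h6] at h8
        rwa [map_smul, smul_eq_mul] at h8
      rcases mul_self_eq_one_iff.1 h9 with h | h
      · rw [h6, h, one_smul]
      · rw [h6, h, neg_one_smul, rf_neg]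
    have h4 := len_of_neg (cs := cs) (t * cs.simple i) (isRoot_al i) (al_nonneg i) (rho_simple cs i) h3
    rw [← mul_assoc] at h4
    exact h4.trans hi
  refine ih _ ?_ (x * cs.simple i) ?_ ?_ rfl
  · rw [← hl]
    convert e3 using 2
    rw [ht, mul_inv_rev, cs.inv_simple]; group
  · rw [mul_inv_rev, cs.inv_simple, rho_mul, rho_simple, ← hc]; exact e1
  · rw [mul_inv_rev, cs.inv_simple, rho_mul, rho_simple, h2']; exact e2

lemma sep_ge {q r : W} {k d : B → ℝ} (hk : IsRoot cs k) (hd : IsRoot cs d) (hk0 : 0 ≤ k) (hd0 : 0 ≤ d)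
    (hq : rho cs q = rf M k) (hr : rho cs r = rf M d) (hrr : cs.IsReflection r)
    (h : SepIdWall cs q r) : 1 ≤ bf M k d := by
  have key := sep_key hrr hk (fun f hf => (len_iff f hk hk0 hq).1 (h.2 f hf))
  by_contra hlt
  push Not at hlt
  set b := bf M k d with hb
  have hdk : bf M d k = b := bf_symm M d k
  have hpos : 0 < b := by
    by_contra h0
    push Not at h0
    apply key 1 (by simpa using hk0)
    rw [inv_one, rho_one, hr, rf_apply, ← hb]
    have : k - (2 * b) • d = k + (-(2*b)) • d := by module
    rw [this]
    exact add_nonneg hk0 (smul_nonneg (by linarith) hd0)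
  have hT : rho cs (r * q) k = - rho cs r k := by
    rw [rho_mul, hq, rf_self M hk.norm, map_neg]
  have hu : ∀ n : ℕ, 0 ≤ rho cs ((r * q)^n) k := by
    intro n
    induction n with
    | zero => simpa using hk0
    | succ n ih =>
      rw [← (hk.rho _).not_nonpos]
      intro h2
      apply key ((r*q)^n)⁻¹ (by simpa using ih)
      rw [pow_succ, rho_mul, hT, map_neg] at h2
      simpa using h2
  have hrec : ∀ n : ℕ, rho cs ((r*q)^(n+2)) k = (4*b^2-2) • rho cs ((r*q)^(n+1)) k - rho cs ((r*q)^n) k := by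
    intro n
    rw [pow_add, pow_add, rho_mul, rho_mul, ← map_smul, ← map_sub]
    congr 1
    rw [pow_two, pow_one, rho_mul, hT, rho_mul, hq, hr]
    simp only [rf_apply, map_sub, map_smul, map_neg, LinearMap.sub_apply, LinearMap.smul_apply, LinearMap.neg_apply, 
      smul_eq_mul, hk.norm, hd.norm, ← hb, hdk]
    module
  obtain ⟨j, hj⟩ : ∃ j, 0 < k j := by
    by_contra hh
    push Not at hh
    exact hk.not_both hk0 hh
  refine seq_contra (fun n => rho cs ((r*q)^n) k j) (4*b^2-2) (by nlinarith) ?_ (by simpa using hj) ?_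
  · intro n
    have := congrFun (hrec n) j
    simpa using this
  · intro n; exact hu n j

noncomputable def es (b : ℝ) {V : Type*} [AddCommGroup V] [Module ℝ V] (a c : V) : ℕ → V
  | 0 => a
  | 1 => c
  | n+2 => (2*b) • es b a c (n+1) - es b a c n

lemma sep_of_ge_aux {z : W} {i : B} {c : B → ℝ} (hc : IsRoot cs c) (hc0 : 0 ≤ c) (hc1 : 0 ≤ rf M (al i) c)
    (hb : 1 ≤ bf M c (al i)) (h1 : 0 ≤ rho cs z (al i)) (h2 : rho cs z c ≤ 0) : False := by
  set b := bf M c (al i) with hbd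
  set e := es b (al i) c with he
  have hroot : ∀ n, IsRoot cs (e n) ∧ IsRoot cs (e (n+1)) ∧ bf M (e (n+1)) (e n) = b := by
    intro n
    induction n with
    | zero => exact ⟨isRoot_al i, hc, hbd.symm⟩
    | succ n ih =>
      obtain ⟨i1, i2, i3⟩ := ih
      have e3 : e (n+1+1) = (2*b) • e (n+1) - e n := rfl
      refine ⟨i2, ?_, ?_⟩
      · have : e (n+1+1) = - rf M (e (n+1)) (e n) := by
          rw [e3, rf_apply, bf_symm, i3]; module
        rw [this]; exact (i2.rf i1).neg
      · rw [e3, map_sub, map_smul, LinearMap.sub_apply, LinearMap.smul_apply, i2.norm, bf_symm, i3, smul_eq_mul]; ring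
  have hD0 : al i ≤ c := by
    rw [rf_apply, ← hbd, sub_nonneg] at hc1
    refine le_trans ?_ hc1
    rw [← sub_nonneg]
    have : (2 * b) • al i - al i = (2*b-1) • (al i) := by module
    rw [this]
    exact smul_nonneg (by linarith) (al_nonneg i)
  have hinc : ∀ n, 0 ≤ e n ∧ c - al i ≤ e (n+1) - e n := by
    intro n
    induction n with
    | zero => exact ⟨al_nonneg i, le_rfl⟩
    | succ n ih =>
      have h3 : 0 ≤ e (n+1) := by
        have : e (n+1) = e n + (e (n+1) - e n) := by abel
        rw [this]
        exact add_nonneg ih.1 (le_trans (sub_nonneg.2 hD0) ih.2)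
      refine ⟨h3, ?_⟩
      have e3 : e (n+1+1) - e (n+1) = (2*b-2) • e (n+1) + (e (n+1) - e n) := by
        have : e (n+1+1) = (2*b) • e (n+1) - e n := rfl
        rw [this]; module
      rw [e3]
      refine le_trans ih.2 ?_
      exact le_add_of_nonneg_left (smul_nonneg (by linarith) h3)
  have hdec : ∀ n, rho cs z (e (n+1)) ≤ 0 ∧ rho cs z (e (n+1)) - rho cs z (e n) ≤ 0 := by
    intro n
    induction n with
    | zero => exact ⟨h2, sub_nonpos.2 (h2.trans h1)⟩
    | succ n ih =>
      have e3 : rho cs z (e (n+1+1)) - rho cs z (e (n+1)) = (2*b-2) • rho cs z (e (n+1)) + (rho cs z (e (n+1)) - rho cs z (e n)) := by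
        have : e (n+1+1) = (2*b) • e (n+1) - e n := rfl
        rw [this, map_sub, map_smul]; module
      have h4 : rho cs z (e (n+1+1)) - rho cs z (e (n+1)) ≤ 0 := by
        rw [e3]
        exact add_nonpos (smul_nonpos_of_nonneg_of_nonpos (by linarith) ih.1) ih.2
      exact ⟨(sub_nonpos.1 h4).trans ih.1, h4⟩
  have hmono : StrictMono e := by
    apply strictMono_nat_of_lt_succ
    intro n
    have h5 := (hinc n).2
    have h6 : 0 < c - al i := by
      refine lt_of_le_of_ne (sub_nonneg.2 hD0) ?_
      intro h
      have : c = al i := by rw [eq_comm, sub_eq_zero] at h; exact h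
      rw [this] at h2
      exact ((isRoot_al i).rho z).not_both h1 h2
    exact sub_pos.1 (h6.trans_le h5)
  have hfin := finite_inv (cs := cs) z
  have hinf : (Set.range fun n => e (n+1)).Infinite :=
    Set.infinite_range_of_injective (fun a b h => by
      have := hmono.injective h; omega)
  refine hinf (hfin.subset ?_)
  rintro _ ⟨n, rfl⟩
  exact ⟨(hroot n).2.1, (hinc (n+1)).1, (hdec n).1⟩

lemma sep_of_ge {r : W} {k d : B → ℝ} (hk : IsRoot cs k) (hd : IsRoot cs d)
    (hr : rho cs r = rf M d) (hb : 1 ≤ bf M k d) (x : W) (h1 : 0 ≤ rho cs x⁻¹ d) (h2 : rho cs x⁻¹ k ≤ 0)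
    (f : W) (hf : AdjWall cs f r) : rho cs f⁻¹ k ≤ 0 := by
  have main : ∀ f : W, ∀ i, rho cs f (al i) = d → 0 ≤ rho cs f⁻¹ k → 0 ≤ rho cs (cs.simple i) (rho cs f⁻¹ k) → False := by
    intro f i hf h3 h4
    rw [rho_simple] at h4
    refine sep_of_ge_aux (cs := cs) (z := x⁻¹ * f) (i := i) (hk.rho f⁻¹) h3 h4 ?_ ?_ ?_
    · rwa [← rho_bf cs f, rho_inv', hf]
    · rwa [rho_mul, hf]
    · rwa [rho_mul, rho_inv']
  rw [← (hk.rho _).not_nonneg]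
  intro h3
  obtain ⟨i, hi⟩ := hf
  have hda := adj_root hd.norm hr hi
  have h4 : 0 ≤ rho cs (cs.simple i) (rho cs f⁻¹ k) := by
    rw [rho_simple]
    refine simple_pos' (hk.rho _) h3 ?_
    intro h5
    have h6 : k = rho cs f (al i) := by rw [← h5, rho_inv']
    rcases hda with h | h
    · rw [h] at h6; rw [h6] at h2
      exact (hd.rho _).not_both h1 h2
    · rw [h6, h, map_neg, LinearMap.neg_apply, hd.norm] at hb
      linarith
  rcases hda with h | h
  · exact main f i h h3 h4
  · refine main (f * cs.simple i) i ?_ ?_ ?_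
    · rw [rho_mul, rho_simple, rf_self M (bf_self M i), map_neg, h, neg_neg]
    · rw [mul_inv_rev, cs.inv_simple, rho_mul]; exact h4
    · rw [mul_inv_rev, cs.inv_simple, rho_mul, ← rho_mul, cs.simple_mul_simple_self, rho_one]; exact h3

def InN (cs : CoxeterSystem M W) (y : W) (e : B → ℝ) : Prop := IsRoot cs e ∧ 0 ≤ e ∧ rho cs y e ≤ 0

def NE (cs : CoxeterSystem M W) (y : W) (g : B → ℝ) : Prop := ∃ e, InN cs y e ∧ bf M e g ≤ -1

lemma not_elem_of_NE {y r : W} {g : B → ℝ} (hg : IsRoot cs g) (hg0 : 0 ≤ g)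
    (hr : rho cs r = rf M (rho cs y g)) (h : NE cs y g) : ¬ IsElementary cs r := by
  obtain ⟨e, ⟨he, he0, hye⟩, hb⟩ := h
  rintro ⟨_, hel⟩
  apply hel
  have hkr : IsRoot cs (-(rho cs y e)) := (he.rho y).neg
  have hk0 : 0 ≤ -(rho cs y e) := by simpa using hye
  obtain ⟨q, hq, hq2⟩ := root_refl hkr
  refine ⟨q, hq, fun f hf => (len_iff f hkr hk0 hq2).2 ?_⟩
  refine sep_of_ge hkr (hg.rho y) hr ?_ y ?_ ?_ f hf
  · rw [map_neg, LinearMap.neg_apply, rho_bf]; linarith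
  · rwa [rho_inv]
  · rw [map_neg, rho_inv]; simpa using he0

lemma NE_of_not_elem {y : W} {p : B} (h0 : 0 ≤ rho cs y (al p))
    (h : ¬ IsElementary cs (y * cs.simple p * y⁻¹)) : NE cs y (al p) := by
  have hrr : cs.IsReflection (y * cs.simple p * y⁻¹) := ⟨y, p, rfl⟩
  rw [IsElementary, not_and, not_not] at h
  obtain ⟨q, hq⟩ := h hrr
  obtain ⟨k, hk, hk0, hqk⟩ := refl_root hq.1
  have hge := sep_ge hk ((isRoot_al p).rho y) hk0 h0 hqk (rho_conj y p) hrr hq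
  have hy := (len_iff y hk hk0 hqk).1 (hq.2 y ⟨p, by group⟩)
  refine ⟨-(rho cs y⁻¹ k), ⟨(hk.rho _).neg, by simpa using hy, ?_⟩, ?_⟩
  · rw [map_neg, rho_inv']; simpa using hk0
  · rw [map_neg, LinearMap.neg_apply, ← rho_bf cs y, rho_inv']; linarith

end geom
end Gar

namespace Gar
open Real

def G3 (m l1 l2 : ℕ) (hm : 2 ≤ m) (h1 : 2 ≤ l1) (h2 : 2 ≤ l2) : CoxeterMatrix (Fin 3) where
  M := !![1, m, l1; m, 1, l2; l1, l2, 1]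
  isSymm := by
    ext i j; fin_cases i <;> fin_cases j <;> simp
  diagonal := by intro i; fin_cases i <;> simp
  off_diagonal := by
    intro i j hij
    fin_cases i <;> fin_cases j <;> simp at hij ⊢ <;> omega

section r3
variable {m l1 l2 : ℕ} {hm : 2 ≤ m} {h1 : 2 ≤ l1} {h2 : 2 ≤ l2}

lemma bf_G3 (x y : Fin 3 → ℝ) : bf (G3 m l1 l2 hm h1 h2) x y =
    x 0 * y 0 + x 1 * y 1 + x 2 * y 2 - cos (π/m) * (x 0 * y 1 + x 1 * y 0)
     - cos (π/l1) * (x 0 * y 2 + x 2 * y 0) - cos (π/l2) * (x 1 * y 2 + x 2 * y 1) := by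
  simp [bf, Matrix.toBilin'_apply, Fin.sum_univ_three, G3]
  ring

abbrev R3 (G : CoxeterMatrix (Fin 3)) (x : Fin 3 → ℝ) : Prop := IsRoot G.toCoxeterSystem x

lemma rank3_case1 {s t2 : ℝ} (hs : s = cos (π/m)) (ht : t2 = cos (π/l2)) (hl1 : l1 = 2) (ht0 : 0 ≤ t2)
    (hs0 : 0 < s) {E : Fin 3 → ℝ} (hE : R3 (G3 m l1 l2 hm h1 h2) E) (hE0 : 0 ≤ E) (hz : 0 < E 2)
    (hb : E 0 - s * E 1 ≤ -1) : ∃ η, R3 (G3 m l1 l2 hm h1 h2) η ∧ 0 ≤ η ∧ ∃ u : ℝ, 0 < u ∧ ∃ p q : ℝ, 0 ≤ p ∧ 0 ≤ q ∧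
      E = u • η + p • al 0 + q • al 1 ∧ bf (G3 m l1 l2 hm h1 h2) η (al 1 + (2*s) • al 0) ≤ -1 := by
  subst hl1
  have e0 := hE0 0
  have e1 := hE0 1
  simp only [Pi.zero_apply] at e0 e1
  have hn := hE.norm
  rw [bf_G3, ← hs, ← ht] at hn
  simp at hn
  have hy : 0 < E 1 := by
    by_contra h
    have : E 1 = 0 := le_antisymm (not_lt.1 h) e1
    rw [this] at hb; linarith
  have hc : 1 ≤ s^2 + t2^2 := by
    by_contra h
    push Not at h
    nlinarith [sq_nonneg (E 2 - t2 * E 1), mul_pos (mul_pos hy hy) (sub_pos.2 h)]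
  have hs1 : s < 1 := by
    rw [hs, ← Real.cos_zero]
    have : (0:ℝ) < m := by positivity
    apply Real.cos_lt_cos_of_nonneg_of_le_pi le_rfl
    · rw [div_le_iff₀ this]
      have : (2:ℝ) ≤ m := by exact_mod_cast hm
      nlinarith [pi_pos]
    · positivity
  have htp : 0 < t2 := by
    refine lt_of_le_of_ne ht0 ?_
    rintro rfl
    nlinarith
  have hr := (isRoot_al 2).rf hE
  have hyz : E 2 ≤ 2 * t2 * E 1 := by
    rcases hr.sign with h | h
    · have := h 2
      simp [rf_apply, al, bf_G3, ← ht] at this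
      linarith
    · have := h 1
      simp [rf_apply, al] at this
      linarith
  refine ⟨rf _ (al 2) (al 1), (isRoot_al 2).rf (isRoot_al 1), ?_, E 2 / (2*t2), by positivity, E 0, E 1 - E 2 / (2*t2), e0, ?_, ?_, ?_⟩
  · intro i
    fin_cases i <;> simp [rf_apply, al, bf_G3, ← ht, ht0]
  · rw [sub_nonneg, div_le_iff₀ (by positivity)]; linarith
  · ext i
    fin_cases i <;> simp [rf_apply, al, bf_G3, ← ht]
    field_simp
  · simp [rf_apply, al, bf_G3, ← ht, ← hs]
    nlinarith

lemma cos_facts (hm4 : 4 ≤ m) : cos (π/m) < 1 ∧ 1/2 ≤ cos (π/m)^2 ∧ 0 < cos (π/m) ∧ 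
    (m < 6 → cos (π/m)^2 < 3/4) ∧ (m = 6 → cos (π/m)^2 = 3/4) ∧ (7 ≤ m → 89/100 ≤ cos (π/m)) := by
  have hM : (4:ℝ) ≤ m := by exact_mod_cast hm4
  have hM0 : (0:ℝ) < m := by linarith
  have hp := pi_pos
  have hle : π/m ≤ π/4 := div_le_div_of_nonneg_left hp.le (by norm_num) hM
  have hpos : 0 < π/m := by positivity
  have h4 : cos (π/4) ≤ cos (π/m) := Real.cos_le_cos_of_nonneg_of_le_pi hpos.le (by linarith) hle
  rw [Real.cos_pi_div_four] at h4
  have hs2 : (0:ℝ) < √2 := by positivity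
  have hs22 : √2 * √2 = 2 := Real.mul_self_sqrt (by norm_num)
  refine ⟨?_, ?_, ?_, ?_, ?_, ?_⟩
  · rw [← Real.cos_zero]
    exact Real.cos_lt_cos_of_nonneg_of_le_pi le_rfl (by linarith) hpos
  · nlinarith
  · linarith
  · intro h6
    have : (m:ℝ) < 6 := by exact_mod_cast h6
    have h7 : π/6 < π/m := div_lt_div_of_pos_left hp hM0 this
    have := Real.cos_lt_cos_of_nonneg_of_le_pi (by positivity) (by linarith) h7
    rw [Real.cos_pi_div_six] at this
    have h3 : √3 * √3 = 3 := Real.mul_self_sqrt (by norm_num)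
    nlinarith
  · rintro rfl
    push_cast
    rw [Real.cos_pi_div_six]
    have h3 : √3 * √3 = 3 := Real.mul_self_sqrt (by norm_num)
    nlinarith
  · intro h7
    have : (7:ℝ) ≤ m := by exact_mod_cast h7
    have h8 : π/m ≤ π/7 := div_le_div_of_nonneg_left hp.le (by norm_num) this
    have h9 := Real.one_sub_sq_div_two_le_cos (x := π/m)
    have := Real.pi_lt_d2
    have h10 : π/m ≤ 0.46 := by linarith
    nlinarith

lemma cube_aux {s : ℝ} (h : 89/100 ≤ s) : 2*s - 4*s^3 ≤ -1 := by
  have h1 : 7921/10000 ≤ s^2 := by nlinarith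
  nlinarith

set_option maxHeartbeats 800000 in
lemma rank3_case2 {s : ℝ} (hs : s = cos (π/m)) (hm4 : 4 ≤ m) (hl1 : l1 = 3) (hl2 : l2 = 2)
    {E : Fin 3 → ℝ} (hE : R3 (G3 m l1 l2 hm h1 h2) E) (hE0 : 0 ≤ E) (hz : 0 < E 2)
    (hb : E 0 - s * E 1 - E 2 / 2 ≤ -1) : ∃ η, R3 (G3 m l1 l2 hm h1 h2) η ∧ 0 ≤ η ∧ ∃ u : ℝ, 0 < u ∧ ∃ p q : ℝ, 0 ≤ p ∧ 0 ≤ q ∧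
      E = u • η + p • al 0 + q • al 1 ∧ bf (G3 m l1 l2 hm h1 h2) η (al 1 + (2*s) • al 0) ≤ -1 := by
  subst hl1 hl2
  obtain ⟨c1, c2, c3, c4, c5, c6⟩ := cos_facts hm4
  rw [← hs] at c1 c2 c3 c4 c5 c6
  have e0 := hE0 0
  have e1 := hE0 1
  simp only [Pi.zero_apply] at e0 e1
  have hn := hE.norm
  rw [bf_G3, ← hs] at hn
  simp at hn
  have hy : 0 < E 1 := by
    by_contra h
    have : E 1 = 0 := le_antisymm (not_lt.1 h) e1
    rw [this] at hb hn; nlinarith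
  have r1 := (isRoot_al 2).rf hE
  have r2 := (isRoot_al 0).rf r1
  have r3 := (isRoot_al 1).rf r2
  have hxz : E 2 ≤ E 0 := by
    rcases r1.sign with h | h
    · have := h 2
      simp [rf_apply, al, bf_G3, ← hs] at this
      linarith
    · have := h 1
      simp [rf_apply, al] at this
      linarith
  have hzy : E 2 ≤ 2 * s * E 1 := by
    rcases r2.sign with h | h
    · have := h 0
      simp [rf_apply, al, bf_G3, ← hs] at this
      linarith
    · have := h 1
      simp [rf_apply, al] at this
      linarith
  have hyz : 2 * s * E 2 ≤ (4 * s^2 - 1) * E 1 := by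
    rcases r3.sign with h | h
    · have := h 1
      simp [rf_apply, al, bf_G3, ← hs] at this
      nlinarith
    · have g0 := h 0
      have g2 := h 2
      simp [rf_apply, al, bf_G3, ← hs] at g0 g2
      nlinarith
  have hq : (1-s^2) * E 1^2 - s * E 1 * E 2 + 3/4 * E 2 ^2 ≤ 0 := by nlinarith
  rcases lt_trichotomy m 6 with h6 | h6 | h6
  · have := c4 h6
    exfalso
    nlinarith [sq_nonneg (3/2 * E 2 - s * E 1), mul_pos hy hy]
  · have h34 := c5 h6
    have hyz2 : s * E 2 = E 1 / 2 := by
      have : (E 1 / 2 - s * E 2)^2 ≤ 0 := by nlinarith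
      have := pow_eq_zero_iff (two_ne_zero) |>.1 (le_antisymm this (sq_nonneg _))
      linarith
    have h3 : s * s^2 = s * (3/4) := by rw [h34]
    have heta : rf (G3 m 3 2 hm h1 h2) (al 2) (rf (G3 m 3 2 hm h1 h2) (al 0) (rf (G3 m 3 2 hm h1 h2) (al 1) (rf (G3 m 3 2 hm h1 h2) (al 0) (al 1)))) = ![2*s, 2, 2*s] := by
      ext i
      fin_cases i <;> simp [rf_apply, al, bf_G3, ← hs] <;> ring_nf <;> linarith
    obtain ⟨v, hv⟩ : ∃ v : Fin 3 → ℝ, v = ![2*s, 2, 2*s] := ⟨_, rfl⟩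
    have v0 : v 0 = 2*s := by rw [hv]; rfl
    have v1 : v 1 = 2 := by rw [hv]; rfl
    have v2 : v 2 = 2*s := by rw [hv]; rfl
    rw [← hv] at heta
    refine ⟨v, heta ▸
      (isRoot_al 2).rf ((isRoot_al 0).rf ((isRoot_al 1).rf ((isRoot_al 0).rf (isRoot_al 1)))), ?_, 
      E 2 / (2*s), by positivity, E 0 - E 2, E 1 - E 2 / s, by linarith, ?_, ?_, ?_⟩
    · intro i
      fin_cases i <;> simp [v0, v1, v2] <;> linarith
    · rw [sub_nonneg, div_le_iff₀ c3]; nlinarith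
    · ext i
      fin_cases i <;> simp [al, v0, v1, v2] <;> field_simp <;> ring
    · simp [al, bf_G3, ← hs, v0, v1, v2]
      nlinarith
  · have := c6 h6
    have hk : 0 < 4 * s^2 - 1 := by nlinarith
    refine ⟨rf _ (al 2) (rf _ (al 0) (rf _ (al 1) (al 0))),
      (isRoot_al 2).rf ((isRoot_al 0).rf ((isRoot_al 1).rf (isRoot_al 0))), ?_, 
      E 2 / (4*s^2-1), by positivity, E 0 - E 2, E 1 - E 2 / (4*s^2-1) * (2*s), by linarith, ?_, ?_, ?_⟩
    · intro i
      fin_cases i <;> simp [rf_apply, al, bf_G3, ← hs] <;> nlinarith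
    · rw [sub_nonneg, div_mul_eq_mul_div, div_le_iff₀ hk]; nlinarith
    · ext i
      fin_cases i <;> simp [rf_apply, al, bf_G3, ← hs] <;> field_simp <;> ring
    · have hfin := cube_aux this
      simp [rf_apply, al, bf_G3, ← hs]
      ring_nf at hfin ⊢
      linarith

end r3
end Gar

namespace Gar
open Real

lemma sub_mult (S : Set ℝ) (h0 : (0:ℝ) ∈ S) (hc : ∀ x ∈ S, ∀ y ∈ S, 2 * x - y ∈ S) {t : ℝ} (ht : t ∈ S) 
    {x : ℝ} (hx : x ∈ S) (k : ℤ) : x + 2 * k * t ∈ S := by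
  have hneg : ∀ x ∈ S, -x ∈ S := fun x hx => by simpa using hc 0 h0 x hx
  have hadd : ∀ x ∈ S, x + 2 * t ∈ S := fun x hx => by
    have := hc t ht _ (hneg x hx)
    convert this using 1; ring
  have hsub : ∀ x ∈ S, x - 2 * t ∈ S := fun x hx => by
    have := hneg _ (hadd _ (hneg x hx))
    convert this using 1; ring
  induction k using Int.induction_on with
  | zero => simpa using hx
  | succ k ih =>
    have := hadd _ ih
    convert this using 1; push_cast; ring
  | pred k ih =>
    have := hsub _ ih
    convert this using 1; push_cast; ring

lemma mult_mem (S : Set ℝ) (h0 : (0:ℝ) ∈ S) (hc : ∀ x ∈ S, ∀ y ∈ S, 2 * x - y ∈ S) {t : ℝ} (ht : t ∈ S) 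
    (k : ℤ) : k * t ∈ S := by
  rcases Int.even_or_odd' k with ⟨j, rfl | rfl⟩
  · have := sub_mult S h0 hc ht h0 j
    convert this using 1; push_cast; ring
  · have := sub_mult S h0 hc ht ht j
    convert this using 1; push_cast; ring

lemma mult_of_mem (S : Set ℝ) (h0 : (0:ℝ) ∈ S) (hc : ∀ x ∈ S, ∀ y ∈ S, 2 * x - y ∈ S) {t : ℝ} (ht : t ∈ S) 
    (htp : 0 < t) (hmin : ∀ x ∈ S, 0 < x → t ≤ x) {x : ℝ} (hx : x ∈ S) : ∃ k : ℤ, x = k * t := by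
  have hneg : ∀ x ∈ S, -x ∈ S := fun x hx => by simpa using hc 0 h0 x hx
  obtain ⟨k, hk⟩ : ∃ k : ℤ, k = round (x / (2*t)) := ⟨_, rfl⟩
  have h1 := abs_sub_round (x / (2*t))
  rw [← hk] at h1
  have hz := sub_mult S h0 hc ht hx (-k)
  set z := x + 2 * ((-k : ℤ):ℝ) * t with hzd
  have hzt : |z| ≤ t := by
    have : z = (x / (2*t) - k) * (2*t) := by rw [hzd]; push_cast; field_simp; ring
    rw [this, abs_mul, abs_of_pos (by linarith : 0 < 2*t)]
    nlinarith
  rw [abs_le] at hzt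
  have hx2 : x = z + 2 * k * t := by rw [hzd]; push_cast; ring
  rcases lt_trichotomy z 0 with h | h | h
  · have := hmin _ (hneg _ hz) (by linarith)
    refine ⟨2 * k - 1, ?_⟩
    push_cast
    have : z = -t := by linarith
    rw [hx2, this]; ring
  · refine ⟨2 * k, ?_⟩
    push_cast; rw [hx2, h]; ring
  · have := hmin _ hz h
    refine ⟨2 * k + 1, ?_⟩
    push_cast
    have : z = t := by linarith
    rw [hx2, this]; ring

section geom
variable {B : Type*} [Fintype B] [DecidableEq B] {M : CoxeterMatrix B}
  {W : Type*} [Group W] {cs : CoxeterSystem M W}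

inductive Cl (M : CoxeterMatrix B) (X : Set (B → ℝ)) : (B → ℝ) → Prop
  | base {x} : x ∈ X → Cl M X x
  | step {x y} : Cl M X x → Cl M X y → Cl M X (rf M x y)

lemma Cl.root {X : Set (B → ℝ)} (hX : ∀ x ∈ X, IsRoot cs x) {x : B → ℝ} (h : Cl M X x) : IsRoot cs x := by
  induction h with
  | base h => exact hX _ h
  | step _ _ h1 h2 => exact h1.rf h2

lemma Cl.trans {X Y : Set (B → ℝ)} (hX : ∀ x ∈ X, Cl M Y x) {x : B → ℝ} (h : Cl M X x) : Cl M Y x := by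
  induction h with
  | base h => exact hX _ h
  | step _ _ h1 h2 => exact h1.step h2

def ht (v : B → ℝ) : ℝ := ∑ i, v i

lemma N_lower {y : W} {p : B} (hp : 0 ≤ rho cs y (al p)) {d d' : B → ℝ} (hd : InN cs y d) (hd' : IsRoot cs d')
    {x u : ℝ} (hx : 0 < x) (hu : 0 ≤ u) (e : d' = x • d - u • al p) : InN cs y d' := by
  obtain ⟨h1, h2, h3⟩ := hd
  refine ⟨hd', ?_, ?_⟩
  · rw [← hd'.not_nonpos]
    intro h
    have h4 : ∀ j, j ≠ p → d j = 0 := by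
      intro j hj
      have := h j
      rw [e] at this
      simp [al, hj] at this
      refine le_antisymm ?_ (h2 j)
      by_contra h5
      push Not at h5
      have h7 : 0 < d j := h5
      nlinarith
    have h5 : d = d p • al p := by
      ext j
      by_cases hj : j = p
      · subst hj; simp [al]
      · simp [al, hj, h4 j hj]
    have h6 : 0 ≤ rho cs y d := by
      rw [h5, map_smul]
      exact smul_nonneg (h2 p) hp
    exact (h1.rho y).not_both h6 h3
  · rw [e, map_sub, map_smul, map_smul, sub_nonpos]
    exact (smul_nonpos_of_nonneg_of_nonpos hx.le h3).trans (smul_nonneg hu hp)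

lemma ht_pos {d : B → ℝ} (hd : IsRoot cs d) (h0 : 0 ≤ d) : 0 < ht d := by
  apply Finset.sum_pos'
  · intro i _; exact h0 i
  · by_contra h
    push Not at h
    exact hd.not_both h0 fun i => h i (Finset.mem_univ i)

lemma ht_lower {d d' : B → ℝ} {p : B} {x u : ℝ} (e : d' = x • d - u • al p) : ht d' = x * ht d - u := by
  rw [e]
  simp [ht, Finset.sum_sub_distrib, ← Finset.mul_sum, al]

lemma minimal_sharp {y : W} {p : B} (hp : 0 ≤ rho cs y (al p)) {r : B → ℝ} (hr : InN cs y r)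
    (hmin : ∀ r', InN cs y r' → Cl M {al p, r'} r → ht r ≤ ht r') :
    bf M r (al p) ≤ -1 ∨ ∃ l : ℕ, 2 ≤ l ∧ bf M r (al p) = - cos (π / l) := by
  set β := bf M r (al p) with hβ
  have haa := bf_self M p
  have hrr := hr.1.norm
  have hβ0 : β ≤ 0 := by
    by_contra h
    push Not at h
    have e : rf M (al p) r = (1:ℝ) • r - (2*β) • al p := by rw [rf_apply, one_smul]
    have h1 := N_lower hp hr ((isRoot_al p).rf hr.1) one_pos (by linarith) e
    have h2 := hmin _ h1 (by
      have := Cl.step (M := M) (X := {al p, rf M (al p) r}) (x := al p) (y := rf M (al p) r) (.base (by simp)) (.base (by simp))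
      rwa [rf_rf M haa] at this)
    rw [ht_lower e] at h2
    linarith
  by_cases hβ1 : β ≤ -1
  · exact Or.inl hβ1
  right
  push Not at hβ1
  obtain ⟨ψ, hψ⟩ : ∃ ψ, ψ = arccos β := ⟨_, rfl⟩
  have hcos : cos ψ = β := by rw [hψ, Real.cos_arccos (by linarith) (by linarith)]
  have hψ1 : π/2 ≤ ψ := by
    by_contra h
    push Not at h
    have h0 : 0 ≤ ψ := hψ ▸ arccos_nonneg β
    have := Real.cos_pos_of_mem_Ioo (x := ψ) ⟨by linarith [pi_pos], h⟩
    linarith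
  have hψ2 : ψ < π := by
    refine lt_of_le_of_ne (hψ ▸ arccos_le_pi β) ?_
    rintro h
    rw [h, cos_pi] at hcos; linarith
  have hpi := pi_pos
  have hsin : 0 < sin ψ := sin_pos_of_pos_of_lt_pi (by linarith) hψ2
  obtain ⟨n, hn⟩ : ∃ n, n = (sin ψ)⁻¹ • (r - β • al p) := ⟨_, rfl⟩
  have hrn : r = cos ψ • al p + sin ψ • n := by
    rw [hn, smul_smul, mul_inv_cancel₀ hsin.ne', one_smul, hcos]; abel
  have har : bf M (al p) r = β := bf_symm M _ _
  have hna : bf M n (al p) = 0 := by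
    rw [hn, map_smul, LinearMap.smul_apply, map_sub, LinearMap.sub_apply, map_smul, LinearMap.smul_apply, haa, ← hβ]
    simp
  have han : bf M (al p) n = 0 := by rw [bf_symm, hna]
  have hnn : bf M n n = 1 := by
    have h1 : bf M (r - β • al p) (r - β • al p) = sin ψ ^2 := by
      simp only [map_sub, map_smul, LinearMap.sub_apply, LinearMap.smul_apply, smul_eq_mul, haa, hrr, ← hβ, har]
      rw [Real.sin_sq, hcos]; ring
    rw [hn, map_smul, map_smul, LinearMap.smul_apply, h1]
    simp only [smul_eq_mul]
    field_simp
  obtain ⟨P, hP⟩ : ∃ P : ℝ → B → ℝ, ∀ t, P t = cos t • al p + sin t • n := ⟨_, fun _ => rfl⟩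
  have hPP : ∀ s t, bf M (P s) (P t) = cos (s - t) := by
    intro s t
    simp only [hP, map_add, map_smul, LinearMap.add_apply, LinearMap.smul_apply, smul_eq_mul, haa, han, hna, hnn]
    rw [Real.cos_sub]; ring
  have hPrf : ∀ s t, rf M (P s) (P t) = - P (2*s - t) := by
    intro s t
    rw [rf_apply, hPP, hP, hP, hP]
    have e1 : cos t - 2 * cos (t - s) * cos s = - cos (2*s-t) := by
      have := Real.two_mul_cos_mul_cos (t-s) s
      rw [this, show t - s - s = -(2*s-t) by ring, cos_neg, show t - s + s = t by ring]; ring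
    have e2 : sin t - 2 * cos (t - s) * sin s = - sin (2*s-t) := by
      have := Real.two_mul_sin_mul_cos s (t-s)
      rw [show 2 * cos (t - s) * sin s = 2 * sin s * cos (t-s) by ring, this, show s - (t - s) = 2*s-t by ring, show s + (t-s) = t by ring]; ring
    have : cos t • al p + sin t • n - (2 * cos (t - s)) • (cos s • al p + sin s • n) = 
      (cos t - 2 * cos (t-s) * cos s) • al p + (sin t - 2 * cos (t-s) * sin s) • n := by module
    rw [this, e1, e2]; module
  have hPneg : ∀ t, P (t + π) = - P t := by
    intro t; rw [hP, hP, cos_add_pi, sin_add_pi]; module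
  have hP0 : P 0 = al p := by rw [hP]; simp
  have hPψ : P ψ = r := by rw [hP]; exact hrn.symm
  have hclneg : ∀ X : Set (B → ℝ), ∀ t, Cl M X (P t) → Cl M X (P (t + π)) := by
    intro X t h
    have := h.step h
    rw [hPrf] at this
    rw [hPneg]
    convert this using 2; ring_nf
  have hcl : ∀ X : Set (B → ℝ), ∀ s ∈ {t | Cl M X (P t)}, ∀ t ∈ {t | Cl M X (P t)}, 2 * s - t ∈ {t | Cl M X (P t)} := by
    intro X s hs t ht
    have h1 : Cl M X (rf M (P s) (P t)) := Cl.step hs ht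
    have h2 : Cl M X (P (2 * s - t + π)) := by rw [hPneg, ← hPrf]; exact h1
    have h3 := hclneg _ _ h2
    rw [hPneg, hPneg, neg_neg] at h3
    exact h3
  set S : Set ℝ := {t | Cl M {al p, r} (P t)} with hS
  have hS0 : (0:ℝ) ∈ S := by
    show Cl M _ (P 0); rw [hP0]; exact .base (by simp)
  have hSψ : ψ ∈ S := by
    show Cl M _ (P ψ); rw [hPψ]; exact .base (by simp)
  have hSneg : ∀ x ∈ S, -x ∈ S := fun x hx => by
    have := hcl _ 0 hS0 x hx
    rwa [mul_zero, zero_sub] at this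
  have hSpi : ∀ x ∈ S, x + π ∈ S := fun x hx => hclneg _ _ hx
  have hroot : ∀ t ∈ S, IsRoot cs (P t) := fun t ht => Cl.root (by
    intro x hx
    rcases hx with rfl | rfl
    · exact isRoot_al p
    · exact hr.1) ht
  have hcomb : ∀ t, P t = (sin t / sin ψ) • r - (sin (t - ψ) / sin ψ) • al p := by
    intro t
    rw [hP]
    have h1 : n = (sin ψ)⁻¹ • (r - cos ψ • al p) := by rw [hcos, hn]
    rw [h1, sin_sub]
    have h2 : cos t = cos t * sin ψ / sin ψ := by field_simp
    rw [h2]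
    have : (sin t * cos ψ - cos t * sin ψ / sin ψ * sin ψ) / sin ψ = sin t / sin ψ * cos ψ - cos t * sin ψ / sin ψ := by
      field_simp
    rw [this]
    module
  have hN : ∀ t ∈ S, ψ ≤ t → t < π → InN cs y (P t) := by
    intro t hts h1 h2
    refine N_lower hp hr (hroot t hts) ?_ ?_ (hcomb t)
    · exact div_pos (sin_pos_of_pos_of_lt_pi (by linarith) h2) hsin
    · exact div_nonneg (sin_nonneg_of_nonneg_of_le_pi (by linarith) (by linarith)) hsin.le
  -- the minimal angle
  obtain ⟨t, ⟨htS, ht0, htψ⟩, htmin⟩ : ∃ t ∈ {t | t ∈ S ∧ 0 < t ∧ t ≤ π - ψ}, ∀ s ∈ {t | t ∈ S ∧ 0 < t ∧ t ≤ π - ψ}, t ≤ s := by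
    apply Set.exists_min_image _ id
    · refine Set.Finite.of_finite_image (f := fun t => P (π - t)) ?_ ?_
      · refine (finite_inv (cs := cs) y).subset ?_
        rintro _ ⟨t, ⟨h1, h2, h3⟩, rfl⟩
        refine hN _ ?_ (by linarith) (by linarith)
        have := hSpi _ (hSneg _ h1)
        convert this using 1; ring
      · rintro t ⟨_, h1, h2⟩ t' ⟨_, h3, h4⟩ h5
        have h6 := congrArg (bf M (al p)) h5
        simp only [← hP0, hPP] at h6
        simp only [zero_sub, cos_neg] at h6
        have := Real.injOn_cos (⟨by linarith, by linarith⟩ : π - t ∈ Set.Icc 0 π) (⟨by linarith, by linarith⟩ : π - t' ∈ Set.Icc 0 π) h6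
        linarith
    · refine ⟨π - ψ, ?_, by linarith, le_rfl⟩
      have := hSpi _ (hSneg _ hSψ)
      convert this using 1; ring
  have htmin' : ∀ x ∈ S, 0 < x → t ≤ x := by
    intro x hx hx0
    by_cases h : x ≤ π - ψ
    · exact htmin x ⟨hx, hx0, h⟩
    · linarith
  have hmult : ∀ x ∈ S, ∃ k : ℤ, x = k * t := fun x hx => mult_of_mem S hS0 (hcl _) htS ht0 htmin' hx
  have hr'S : π - t ∈ S := by
    have := hSpi _ (hSneg _ htS)
    convert this using 1; ring
  have hr'N := hN _ hr'S (by linarith) (by linarith)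
  have hle := hmin _ hr'N (by
    have k0 : (0:ℝ) ∈ {s | Cl M {al p, P (π - t)} (P s)} := by
      show Cl M _ (P 0); rw [hP0]; exact .base (by simp)
    have k1 : π - t ∈ {s | Cl M {al p, P (π - t)} (P s)} := by
      show Cl M _ (P (π - t)); exact .base (by simp)
    have k2 : t ∈ {s | Cl M {al p, P (π - t)} (P s)} := by
      have h1 := hcl _ _ k0 _ k1
      have h2 := hclneg _ _ h1
      show Cl M _ (P t)
      convert h2 using 2; ring
    obtain ⟨k, hk⟩ := hmult _ hSψ
    have := mult_mem _ k0 (hcl _) k2 k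
    rw [← hk] at this
    rw [← hPψ]; exact this)
  have heq : t = π - ψ := by
    by_contra hne
    have hlt : t < π - ψ := lt_of_le_of_ne htψ hne
    rw [ht_lower (hcomb (π - t))] at hle
    have h1 : 0 < sin (π - t - ψ) / sin ψ := div_pos (sin_pos_of_pos_of_lt_pi (by linarith) (by linarith)) hsin
    have h2 : sin (π - t) / sin ψ ≤ 1 := by
      rw [div_le_one hsin, sin_pi_sub, ← sin_pi_sub ψ]
      exact sin_le_sin_of_le_of_le_pi_div_two (by linarith) (by linarith) hlt.le
    have h3 := ht_pos hr.1 hr.2.1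
    nlinarith
  obtain ⟨k, hk⟩ := hmult π (by simpa using hSpi 0 hS0)
  have hk2 : (2:ℝ) ≤ k := by
    by_contra h
    push Not at h
    have : k ≤ 1 := by
      have : k < 2 := by exact_mod_cast h
      omega
    have : (k:ℝ) ≤ 1 := by exact_mod_cast this
    nlinarith
  have hk2' : 2 ≤ k := by exact_mod_cast hk2
  refine ⟨k.toNat, by omega, ?_⟩
  have : ((k.toNat : ℕ) : ℝ) = k := by
    rw [← Int.cast_natCast, Int.toNat_of_nonneg (by omega)]
  rw [this]
  have h3 : π / k = t := by rw [div_eq_iff (by linarith)]; linarith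
  rw [h3, heq, cos_pi_sub, hcos, neg_neg]

end geom
end Gar

namespace Gar
open Real

section geom
variable {B : Type*} [Fintype B] [DecidableEq B] {M : CoxeterMatrix B}
  {W : Type*} [Group W] {cs : CoxeterSystem M W}

lemma cos_ge_half {l : ℕ} (h : 3 ≤ l) : 1/2 ≤ cos (π / l) := by
  have hM : (3:ℝ) ≤ l := by exact_mod_cast h
  have hp := pi_pos
  have hle : π/l ≤ π/3 := div_le_div_of_nonneg_left hp.le (by norm_num) hM
  rw [← Real.cos_pi_div_three]
  exact Real.cos_le_cos_of_nonneg_of_le_pi (by positivity) (by linarith) hle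

lemma cos_nn {l : ℕ} (h : 2 ≤ l) : 0 ≤ cos (π / l) := by
  have hM : (2:ℝ) ≤ l := by exact_mod_cast h
  have hp := pi_pos
  have hle : π/l ≤ π/2 := div_le_div_of_nonneg_left hp.le (by norm_num) hM
  rw [← Real.cos_pi_div_two]
  exact Real.cos_le_cos_of_nonneg_of_le_pi (by positivity) (by linarith) hle

lemma lemma1 {y : W} {p q : B} (hm : 4 ≤ M p q) (hp : 0 ≤ rho cs y (al p)) (hq : 0 ≤ rho cs y (al q))
    (h : NE cs y (al p)) : NE cs y (rf M (al p) (al q)) := by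
  obtain ⟨ε, hεN, hε⟩ := h
  obtain ⟨s, hs⟩ : ∃ s, s = cos (π / M p q) := ⟨_, rfl⟩
  obtain ⟨c1, c2, c3, -⟩ := cos_facts hm
  rw [← hs] at c1 c2 c3
  have hpq : bf M (al p) (al q) = -s := by rw [hs]; exact bf_al M p q
  have hqp : bf M (al q) (al p) = -s := by rw [bf_symm, hpq]
  have hcc : rf M (al p) (al q) = al q + (2*s) • al p := by rw [rf_apply, hqp]; module
  obtain ⟨r, ⟨hrN, hrC⟩, hrmin⟩ : ∃ r ∈ {r | InN cs y r ∧ Cl M {al p, al q, r} ε},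
      ∀ r' ∈ {r | InN cs y r ∧ Cl M {al p, al q, r} ε}, ht r ≤ ht r' := by
    apply Set.exists_min_image _ ht
    · exact (finite_inv (cs := cs) y).subset fun r h => h.1
    · exact ⟨ε, hεN, .base (by simp)⟩
  have sh1 := minimal_sharp hp hrN (by
    intro r' hr' hc
    refine hrmin r' ⟨hr', hrC.trans ?_⟩
    intro x hx
    rcases hx with rfl | rfl | rfl
    · exact .base (by simp)
    · exact .base (by simp)
    · refine hc.trans ?_
      intro x hx
      rcases hx with rfl | rfl
      · exact .base (by simp)
      · exact .base (by simp))
  have sh2 := minimal_sharp hq hrN (by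
    intro r' hr' hc
    refine hrmin r' ⟨hr', hrC.trans ?_⟩
    intro x hx
    rcases hx with rfl | rfl | rfl
    · exact .base (by simp)
    · exact .base (by simp)
    · refine hc.trans ?_
      intro x hx
      rcases hx with rfl | rfl
      · exact .base (by simp)
      · exact .base (by simp))
  have n1 : bf M r (al p) ≤ 0 := by
    rcases sh1 with h | ⟨l, hl, h⟩
    · linarith
    · rw [h]; linarith [cos_nn hl]
  have n2 : bf M r (al q) ≤ 0 := by
    rcases sh2 with h | ⟨l, hl, h⟩
    · linarith
    · rw [h]; linarith [cos_nn hl]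
  by_cases hdone : bf M r (al q) + 2 * s * bf M r (al p) ≤ -1
  · refine ⟨r, hrN, ?_⟩
    rw [hcc, map_add, map_smul, smul_eq_mul]; exact hdone
  push Not at hdone
  have hs1 : 1 ≤ 2 * s := by nlinarith
  obtain ⟨l1, hl1, e1⟩ := sh1.resolve_left (by nlinarith)
  obtain ⟨l2, hl2, e2⟩ := sh2.resolve_left (by nlinarith)
  have hm2 : 2 ≤ M p q := by omega
  have hrp : bf M (al p) r = - cos (π / l1) := by rw [bf_symm, e1]
  have hrq : bf M (al q) r = - cos (π / l2) := by rw [bf_symm, e2]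
  set G := G3 (M p q) l1 l2 hm2 hl1 hl2 with hG
  obtain ⟨φ, hφ⟩ : ∃ φ : (Fin 3 → ℝ) → (B → ℝ), ∀ v, φ v = v 0 • al p + v 1 • al q + v 2 • r := ⟨_, fun _ => rfl⟩
  have hφb : ∀ u v, bf M (φ u) (φ v) = bf G u v := by
    intro u v
    rw [hG, bf_G3, hφ, hφ, ← hs]
    simp only [map_add, map_smul, LinearMap.add_apply, LinearMap.smul_apply, smul_eq_mul, bf_self, hpq, hqp, hrp, hrq, e1, e2, hrN.1.norm]
    ring
  have hφr : ∀ u v, φ (rf G u v) = rf M (φ u) (φ v) := by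
    intro u v
    rw [rf_apply, rf_apply, hφb, hφ, hφ, hφ]
    simp only [Pi.sub_apply, Pi.smul_apply, smul_eq_mul]
    module
  have p0 : φ (al 0) = al p := by rw [hφ]; simp [al]
  have p1 : φ (al 1) = al q := by rw [hφ]; simp [al]
  have p2 : φ (al 2) = r := by rw [hφ]; simp [al]
  have hφroot : ∀ v, R3 G v → IsRoot cs (φ v) := by
    rintro v ⟨w, i, rfl⟩
    induction w using G.toCoxeterSystem.simple_induction_left with
    | one =>
      rw [rho_one]
      fin_cases i
      · exact p0 ▸ isRoot_al p
      · exact p1 ▸ isRoot_al q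
      · exact p2 ▸ hrN.1
    | mul_simple_left w j ih =>
      rw [rho_mul, rho_simple, hφr]
      refine IsRoot.rf ?_ ih
      fin_cases j
      · exact p0 ▸ isRoot_al p
      · exact p1 ▸ isRoot_al q
      · exact p2 ▸ hrN.1
  obtain ⟨E, hE, hEε⟩ : ∃ E, R3 G E ∧ φ E = ε := by
    have : ∀ x, Cl M {al p, al q, r} x → ∃ E, R3 G E ∧ φ E = x := by
      intro x hx
      induction hx with
      | base h =>
        rcases h with rfl | rfl | rfl
        · exact ⟨_, isRoot_al 0, p0⟩
        · exact ⟨_, isRoot_al 1, p1⟩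
        · exact ⟨_, isRoot_al 2, p2⟩
      | step _ _ i1 i2 =>
        obtain ⟨E1, a1, b1⟩ := i1
        obtain ⟨E2, a2, b2⟩ := i2
        exact ⟨_, a1.rf a2, by rw [hφr, b1, b2]⟩
    exact this ε hrC
  have hφnn : ∀ v, 0 ≤ v → 0 ≤ φ v := by
    intro v hv
    rw [hφ]
    exact add_nonneg (add_nonneg (smul_nonneg (hv 0) (al_nonneg p)) (smul_nonneg (hv 1) (al_nonneg q))) (smul_nonneg (hv 2) hrN.2.1)
  have hφneg : ∀ v, φ (-v) = - φ v := by
    intro v; rw [hφ, hφ]; simp only [Pi.neg_apply]; module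
  have hE0 : 0 ≤ E := by
    rcases hE.sign with h | h
    · exact h
    · exfalso
      have := hφnn (-E) (by simpa using h)
      rw [hφneg, hEε] at this
      exact hεN.1.not_both hεN.2.1 (by simpa using this)
  have hz : 0 < E 2 := by
    refine lt_of_le_of_ne (hE0 2) ?_
    intro h
    have h' : E 2 = 0 := h.symm
    have : 0 ≤ rho cs y ε := by
      rw [← hEε, hφ, h', zero_smul, add_zero, map_add, map_smul, map_smul]
      exact add_nonneg (smul_nonneg (hE0 0) hp) (smul_nonneg (hE0 1) hq)
    exact (hεN.1.rho y).not_both this hεN.2.2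
  have hEb : bf G E (al 0) ≤ -1 := by rw [← hφb, hEε, p0]; exact hε
  have key : ∃ η, R3 G η ∧ 0 ≤ η ∧ ∃ u : ℝ, 0 < u ∧ ∃ p q : ℝ, 0 ≤ p ∧ 0 ≤ q ∧
      E = u • η + p • al 0 + q • al 1 ∧ bf G η (al 1 + (2*s) • al 0) ≤ -1 := by
    rw [hG, bf_G3, ← hs] at hEb
    simp [al] at hEb
    rcases (by omega : l1 = 2 ∨ l1 = 3 ∨ 4 ≤ l1) with h | h | h
    · refine rank3_case1 hs rfl h (cos_nn hl2) c3 hE hE0 hz ?_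
      rw [h] at hEb; simp at hEb; linarith
    · have hl2' : l2 = 2 := by
        by_contra h3
        have h4 := cos_ge_half (l := l2) (by omega)
        rw [e1, e2, h] at hdone
        push_cast at hdone
        rw [Real.cos_pi_div_three] at hdone
        nlinarith
      refine rank3_case2 hs hm h hl2' hE hE0 hz ?_
      rw [h] at hEb; simp at hEb; linarith
    · exfalso
      have := (cos_facts h).2.1
      have h5 := (cos_facts h).2.2.1
      rw [e1, e2] at hdone
      have := cos_nn hl2
      have h6 : 1 ≤ 2 * s * cos (π/l1) := by
        nlinarith [sq_nonneg (s - cos (π/l1)), mul_pos c3 h5]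
      linarith
  obtain ⟨η, hη, hη0, u, hu, a, b, ha, hb, hEe, hfin⟩ := key
  refine ⟨φ η, ⟨hφroot _ hη, hφnn _ hη0, ?_⟩, ?_⟩
  · have h1 : ε = u • φ η + a • al p + b • al q := by
      rw [← hEε, hEe, hφ, hφ]
      simp [al]
      module
    have h2 : rho cs y (φ η) = u⁻¹ • (rho cs y ε - (a • rho cs y (al p) + b • rho cs y (al q))) := by
      rw [h1, map_add, map_add, map_smul, map_smul, map_smul]
      rw [add_assoc, add_sub_cancel_right, smul_smul, inv_mul_cancel₀ hu.ne', one_smul]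
    rw [h2]
    refine smul_nonpos_of_nonneg_of_nonpos (by positivity) ?_
    rw [sub_nonpos]
    exact hεN.2.2.trans (add_nonneg (smul_nonneg ha hp) (smul_nonneg hb hq))
  · have h3 : φ (al 1 + (2*s) • al 0) = rf M (al p) (al q) := by
      rw [hcc, hφ]; simp [al]; abel
    rw [← h3, hφb]; exact hfin

end geom
end Gar

namespace Gar
open Real

lemma sin_mu {m : ℕ} (hm : 2 ≤ m) : 0 < sin (π / m) := by
  have hM : (2:ℝ) ≤ m := by exact_mod_cast hm
  have hp := pi_pos
  apply Real.sin_pos_of_pos_of_lt_pi (by positivity)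
  rw [div_lt_iff₀ (by linarith)]
  nlinarith

lemma U_sub {m j : ℕ} (hm : 2 ≤ m) (hj : j ≤ m) : U (cos (π / m)) (m - j) = U (cos (π / m)) j := by
  have hs := sin_mu hm
  have hM : (2:ℝ) ≤ m := by exact_mod_cast hm
  apply mul_right_cancel₀ hs.ne'
  rw [U_sin, U_sin, Nat.cast_sub hj, sub_mul, mul_div_cancel₀ _ (by linarith : (m:ℝ) ≠ 0), sin_pi_sub]

section geom
variable {B : Type*} [Fintype B] [DecidableEq B] {M : CoxeterMatrix B}
  {W : Type*} [Group W] {cs : CoxeterSystem M W}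

noncomputable def gam (M : CoxeterMatrix B) (p q : B) (n : ℕ) : B → ℝ :=
  U (cos (π / M p q)) (n+1) • al p + U (cos (π / M p q)) n • al q

lemma NE_refl {y : W} {g : B → ℝ} {q : B} (hq : 0 ≤ rho cs y (al q)) (hb : bf M g (al q) ≤ 0)
    (h : NE cs y g) : NE cs y (rf M (al q) g) := by
  obtain ⟨e, he, heb⟩ := h
  by_cases hc : 0 ≤ bf M e (al q)
  · refine ⟨rf M (al q) e, ?_, ?_⟩
    · exact N_lower hq he ((isRoot_al q).rf he.1) one_pos (u := 2 * bf M e (al q)) (by linarith) (by rw [rf_apply, one_smul])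
    · rwa [rf_bf M (bf_self M q)]
  · refine ⟨e, he, ?_⟩
    rw [rf_apply, map_sub, map_smul, smul_eq_mul]
    push Not at hc
    nlinarith

lemma bf_gam_q {p q : B} (h2 : 2 ≤ M p q) {n : ℕ} (hn : 2 * (n+1) ≤ M p q) : bf M (gam M p q n) (al q) ≤ 0 := by
  have hs := sin_mu h2
  have hpq : bf M (al p) (al q) = - cos (π / M p q) := bf_al M p q
  rw [gam, map_add, map_smul, map_smul, LinearMap.add_apply, LinearMap.smul_apply, LinearMap.smul_apply, hpq, bf_self, smul_eq_mul, smul_eq_mul]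
  have hM : (2:ℝ) ≤ M p q := by exact_mod_cast h2
  have hc : 0 ≤ cos ((n+1:ℕ) * (π / M p q)) := by
    apply cos_nonneg_of_neg_pi_div_two_le_of_le
    · have : 0 ≤ ((n+1:ℕ):ℝ) * (π / M p q) := by positivity
      linarith [pi_pos]
    · rw [← mul_div_assoc, div_le_iff₀ (by linarith)]
      have : 2 * ((n+1:ℕ):ℝ) ≤ M p q := by exact_mod_cast hn
      nlinarith [pi_pos]
  have h1 := U_sin (π / M p q) n
  have h3 := U_sin (π / M p q) (n+1)
  have h4 := Real.sin_sub ((n+1:ℕ) * (π / M p q)) (π / M p q)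
  rw [show ((n+1:ℕ):ℝ) * (π / M p q) - π / M p q = n * (π / M p q) by push_cast; ring, ← h1, ← h3] at h4
  nlinarith

lemma bf_gam_p {p q : B} (h2 : 2 ≤ M p q) {n : ℕ} (hn : M p q ≤ 2 * n) (hn2 : n ≤ M p q) : bf M (gam M p q n) (al p) ≤ 0 := by
  have hs := sin_mu h2
  have hpq : bf M (al q) (al p) = - cos (π / M p q) := by rw [bf_symm]; exact bf_al M p q
  rw [gam, map_add, map_smul, map_smul, LinearMap.add_apply, LinearMap.smul_apply, LinearMap.smul_apply, hpq, bf_self, smul_eq_mul, smul_eq_mul]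
  have hM : (2:ℝ) ≤ M p q := by exact_mod_cast h2
  have hc : cos (n * (π / M p q)) ≤ 0 := by
    apply cos_nonpos_of_pi_div_two_le_of_le
    · rw [← mul_div_assoc, le_div_iff₀ (by linarith)]
      have : (M p q : ℝ) ≤ 2 * n := by exact_mod_cast hn
      nlinarith [pi_pos]
    · rw [← mul_div_assoc, div_le_iff₀ (by linarith)]
      have : (n:ℝ) ≤ M p q := by exact_mod_cast hn2
      nlinarith [pi_pos]
  have h1 := U_sin (π / M p q) n
  have h3 := U_sin (π / M p q) (n+1)
  have h4 := Real.sin_add (n * (π / M p q)) (π / M p q)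
  rw [show (n:ℝ) * (π / M p q) + π / M p q = (n+1:ℕ) * (π / M p q) by push_cast; ring, ← h1, ← h3] at h4
  nlinarith

lemma rf_gam_q {p q : B} (h2 : 2 ≤ M p q) {n : ℕ} (hn : n + 2 ≤ M p q) : rf M (al q) (gam M p q n) = gam M p q (M p q - 2 - n) := by
  have hpq : bf M (al p) (al q) = - cos (π / M p q) := bf_al M p q
  have e1 := U_sub h2 (j := n+1) (by omega)
  have e2 := U_sub h2 (j := n+2) (by omega)
  rw [show M p q - (n+1) = M p q - 2 - n + 1 by omega] at e1
  rw [show M p q - (n+2) = M p q - 2 - n by omega] at e2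
  rw [gam, gam, e1, e2, U, rf_apply]
  simp only [map_add, map_smul, LinearMap.add_apply, LinearMap.smul_apply, smul_eq_mul, bf_self, hpq]
  module

lemma rf_gam_p {p q : B} (h2 : 2 ≤ M p q) {n : ℕ} (hn : n + 1 ≤ M p q) : rf M (al p) (gam M p q (n+1)) = gam M p q (M p q - (n+1)) := by
  have hpq : bf M (al q) (al p) = - cos (π / M p q) := by rw [bf_symm]; exact bf_al M p q
  have e1 := U_sub h2 (j := n+1) (by omega)
  have e2 := U_sub h2 (j := n) (by omega)
  rw [show M p q - n = M p q - (n+1) + 1 by omega] at e2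
  rw [gam, gam, e1, e2, show U (cos (π / M p q)) (n+1+1) = 2 * cos (π / M p q) * U (cos (π / M p q)) (n+1) - U (cos (π / M p q)) n from rfl, rf_apply]
  simp only [map_add, map_smul, LinearMap.add_apply, LinearMap.smul_apply, smul_eq_mul, bf_self, hpq]
  module

lemma gam_zero (p q : B) : gam M p q 0 = al p := by simp [gam, U]

lemma NE_gam_small {y : W} {p q : B} (h2 : 2 ≤ M p q) (hp : 0 ≤ rho cs y (al p)) (hq : 0 ≤ rho cs y (al q))
    (h : NE cs y (al p)) (n : ℕ) (hn : 2 * n ≤ M p q) (hn2 : n + 2 ≤ M p q) : NE cs y (gam M p q n) := by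
  induction n using Nat.twoStepInduction with
  | zero => rwa [gam_zero]
  | one =>
    rcases (by omega : M p q = 3 ∨ 4 ≤ M p q) with h3 | h4
    · have := NE_refl hq (bf_gam_q h2 (n := 0) (by omega)) (by rwa [gam_zero])
      rw [rf_gam_q h2 (by omega)] at this
      simpa [h3] using this
    · have := lemma1 h4 hp hq h
      convert this using 1
      have hpq : bf M (al q) (al p) = - cos (π / M p q) := by rw [bf_symm]; exact bf_al M p q
      rw [gam, rf_apply, hpq]
      simp only [U]
      module
  | more n i1 _ =>
    have a := NE_refl hq (bf_gam_q h2 (n := n) (by omega)) (i1 (by omega) (by omega))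
    rw [rf_gam_q h2 (by omega)] at a
    have b := NE_refl hp (bf_gam_p h2 (by omega) (by omega)) a
    rw [show M p q - 2 - n = (M p q - 3 - n) + 1 by omega, rf_gam_p h2 (by omega)] at b
    rwa [show M p q - (M p q - 3 - n + 1) = n + 2 by omega] at b

lemma NE_gam {y : W} {p q : B} (hp : 0 ≤ rho cs y (al p)) (hq : 0 ≤ rho cs y (al q))
    (h : NE cs y (al p)) (n : ℕ) (hn2 : n + 2 ≤ M p q) : NE cs y (gam M p q n) := by
  by_cases hn : 2 * n ≤ M p q
  · exact NE_gam_small (by omega) hp hq h n hn hn2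
  · have := NE_gam_small (by omega) hp hq h (M p q - 2 - n) (by omega) (by omega)
    have a := NE_refl hq (bf_gam_q (by omega) (n := M p q - 2 - n) (by omega)) this
    rw [rf_gam_q (by omega) (by omega)] at a
    rwa [show M p q - 2 - (M p q - 2 - n) = n by omega] at a

end geom
end Gar

namespace Gar
open Real
section fin
variable {B : Type*} [Fintype B] [DecidableEq B] {M : CoxeterMatrix B}
  {W : Type*} [Group W] {cs : CoxeterSystem M W}

lemma wl_def {g h : W} : WeakLe cs g h ↔ cs.length g + cs.length (g⁻¹ * h) = cs.length h := Iff.rfl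

lemma wl_trans {a b c : W} (h1 : WeakLe cs a b) (h2 : WeakLe cs b c) : WeakLe cs a c := by
  rw [wl_def] at *
  have h3 := cs.length_mul_le (a⁻¹ * b) (b⁻¹ * c)
  have h4 := cs.length_mul_le a (a⁻¹ * c)
  rw [show a⁻¹ * b * (b⁻¹ * c) = a⁻¹ * c by group] at h3
  rw [show a * (a⁻¹ * c) = c by group] at h4
  omega

lemma wl_exists {g z : W} (h : WeakLe cs g z) (hne : g ≠ z) :
    ∃ k, cs.IsRightDescent z k ∧ WeakLe cs g (z * cs.simple k) := by
  have : g⁻¹ * z ≠ 1 := by rwa [Ne, inv_mul_eq_one]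
  obtain ⟨k, hk⟩ := cs.exists_rightDescent_of_ne_one this
  rw [cs.isRightDescent_iff] at hk
  rw [wl_def] at h
  have h4 := cs.length_mul_le g (g⁻¹ * (z * cs.simple k))
  rw [show g * (g⁻¹ * (z * cs.simple k)) = z * cs.simple k by group] at h4
  rw [mul_assoc] at hk
  have h5 : cs.IsRightDescent z k := by rw [CoxeterSystem.IsRightDescent]; omega
  refine ⟨k, h5, ?_⟩
  rw [cs.isRightDescent_iff] at h5
  rw [wl_def]; omega

lemma wl_N {q p g : W} (h : WeakLe cs p g) (hq : cs.length (q * p) < cs.length p) :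
    cs.length (q * g) < cs.length g := by
  rw [wl_def] at h
  have h4 := cs.length_mul_le (q * p) (p⁻¹ * g)
  rw [show q * p * (p⁻¹ * g) = q * g by group] at h4
  omega

lemma desc_not_wl {z : W} {i : B} (h : cs.IsRightDescent z i) : ¬ WeakLe cs z (z * cs.simple i) := by
  rw [CoxeterSystem.IsRightDescent] at h; rw [wl_def]; omega

lemma shi_step {r x y : W} (hr : IsElementary cs r) (h : ShiStep cs x y)
    (hx : cs.length (r * x) < cs.length x) : cs.length (r * y) < cs.length y := by
  obtain ⟨i, rfl, hne⟩ := h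
  obtain ⟨d, hd, hd0, hrd⟩ := refl_root hr.1
  rw [len_iff _ hd hd0 hrd] at hx ⊢
  rw [mul_inv_rev, cs.inv_simple, rho_mul, rho_simple]
  have hn := (hd.rho x⁻¹).neg
  have : 0 ≤ rf M (al i) (-(rho cs x⁻¹ d)) := by
    apply simple_pos' hn (by simpa using hx)
    intro he
    apply hne
    convert hr using 1
    apply rho_inj (cs := cs)
    rw [rho_conj, hrd, ← he, map_neg, rf_neg, rho_inv']
  rw [map_neg] at this
  simpa using this

lemma shi_path {r x y : W} (hr : IsElementary cs r) (h : SameShiPart cs x y)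
    (hx : cs.length (r * x) < cs.length x) : cs.length (r * y) < cs.length y := by
  induction h with
  | refl => exact hx
  | tail _ h2 ih => exact shi_step hr h2 ih

lemma range_iff (m : W → W) (hm : ∀ g : W, SameShiPart cs g (m g) ∧
      ∀ h : W, SameShiPart cs g h → WeakLe cs (m g) h) (h : W) :
    h ∈ Set.range m ↔ ∀ i, cs.IsRightDescent h i → IsElementary cs (h * cs.simple i * h⁻¹) := by
  constructor
  · rintro ⟨x, rfl⟩ i hi
    by_contra hne
    exact desc_not_wl hi ((hm x).2 _ (Relation.ReflTransGen.tail (hm x).1 ⟨i, rfl, hne⟩))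
  · intro H
    refine ⟨h, ?_⟩
    by_contra hne
    obtain ⟨k, hk, hw⟩ := wl_exists ((hm h).2 h Relation.ReflTransGen.refl) hne
    have hr := H k hk
    have h1 : cs.length (h * cs.simple k * h⁻¹ * h) < cs.length h := by
      rw [inv_mul_cancel_right]; exact hk
    have h2 := wl_N hw (shi_path hr (hm h).1 h1)
    rw [show h * cs.simple k * h⁻¹ * (h * cs.simple k) = h by
      simp [mul_assoc]] at h2
    rw [CoxeterSystem.IsRightDescent] at hk
    omega

lemma cond1 (i j : B) (h : cs.IsRightDescent (cs.simple i) j) :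
    IsElementary cs (cs.simple i * cs.simple j * (cs.simple i)⁻¹) := by
  have h1 : cs.simple i * cs.simple j = 1 := by
    rw [CoxeterSystem.IsRightDescent, cs.length_simple] at h
    rw [← cs.length_eq_zero_iff]; omega
  rw [h1, one_mul, cs.inv_simple]
  refine ⟨⟨1, i, by simp⟩, ?_⟩
  rintro ⟨q, _, hq⟩
  have := hq 1 ⟨i, by simp⟩
  simp at this

lemma cond2 {g h : W} (hw : WeakLe cs g h) 
    (H : ∀ i, cs.IsRightDescent h i → IsElementary cs (h * cs.simple i * h⁻¹)) (i : B)
    (hi : cs.IsRightDescent (g⁻¹ * h) i) :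
    IsElementary cs ((g⁻¹ * h) * cs.simple i * (g⁻¹ * h)⁻¹) := by
  refine ⟨⟨_, i, rfl⟩, ?_⟩
  rintro ⟨q, hq, hsep⟩
  rw [wl_def] at hw
  have hd : cs.IsRightDescent h i := by
    rw [CoxeterSystem.IsRightDescent] at *
    have h4 := cs.length_mul_le g (g⁻¹ * h * cs.simple i)
    rw [show g * (g⁻¹ * h * cs.simple i) = h * cs.simple i by group] at h4
    omega
  refine (H i hd).2 ⟨g * q * g⁻¹, hq.conj g, ?_⟩
  obtain ⟨d, hdr, hd0, hrd⟩ := refl_root hq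
  have hqk := hsep (g⁻¹ * h) ⟨i, by group⟩
  have hg0 : 0 ≤ rho cs g d := by
    rw [← (hdr.rho g).not_nonpos]
    intro hc
    have := (len_iff g⁻¹ hdr hd0 hrd).2 (by rwa [inv_inv])
    rw [← cs.length_inv (q * g⁻¹), cs.length_inv g, mul_inv_rev, inv_inv, hq.inv] at this
    have h4 := cs.length_mul_le (g * q) (q * (g⁻¹ * h))
    rw [show g * q * (q * (g⁻¹ * h)) = g * (q * q) * (g⁻¹ * h) by group, hq.mul_self, mul_one, mul_inv_cancel_left] at h4
    omega
  have hrg : rho cs (g * q * g⁻¹) = rf M (rho cs g d) := by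
    obtain ⟨w, j, rfl⟩ := hdr
    have : q = w * cs.simple j * w⁻¹ := rho_inj (hrd.trans (rho_conj w j).symm)
    rw [this, ← rho_mul, ← rho_conj]; congr 1; group
  rintro f ⟨j, hj⟩
  have := hsep (g⁻¹ * f) ⟨j, by rw [← hj]; group⟩
  rw [len_iff _ hdr hd0 hrd] at this
  rw [len_iff _ (hdr.rho g) hg0 hrg]
  rwa [mul_inv_rev, inv_inv, rho_mul] at this

/-- alternating product starting with `p` -/
noncomputable def ch (cs : CoxeterSystem M W) (p q : B) (j : ℕ) : W :=
  if Even j then alt cs p q j else alt cs q p j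

def xl (p q : B) (j : ℕ) : B := if Even j then p else q

lemma ch_succ (p q : B) (j : ℕ) : ch cs p q (j+1) = ch cs p q j * cs.simple (xl p q j) := by
  unfold ch xl
  by_cases h : Even j
  · have : ¬ Even (j+1) := by simpa [Nat.even_add_one] using h
    simp only [h, this, if_true, if_false, alt]
  · have : Even (j+1) := by simpa [Nat.even_add_one] using h
    simp only [h, this, if_true, if_false, alt]

lemma xl_succ (p q : B) (j : ℕ) : xl p q (j+1) = xl q p j := by
  unfold xl
  by_cases h : Even j
  · have : ¬ Even (j+1) := by simpa [Nat.even_add_one] using h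
    simp only [h, this, if_true, if_false]
  · have : Even (j+1) := by simpa [Nat.even_add_one] using h
    simp only [h, this, if_true, if_false]

lemma ch_root (p q : B) (j : ℕ) : rho cs (ch cs p q j) (al (xl p q j)) = gam M p q j := by
  unfold ch xl gam
  by_cases h : Even j
  · simp only [h, if_true, alt_al]
  · simp only [h, if_false, alt_al, M.symmetric q p]

lemma ch_braid (p q : B) : ch cs p q (M p q) = ch cs q p (M p q) := by
  have h := cs.wordProd_braidWord_eq p q
  rw [CoxeterSystem.braidWord, CoxeterSystem.braidWord, ← alt_eq, ← alt_eq, M.symmetric q p] at h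
  unfold ch
  rw [h]

lemma ch_len_le (p q : B) (j : ℕ) : cs.length (ch cs p q j) ≤ j := by
  unfold ch; split_ifs <;> exact length_alt_le cs _ _ j

lemma ch_bound {v : W} {p q : B} {n : ℕ} (h : cs.length (v * ch cs p q n) = cs.length v + n) :
    M p q = 0 ∨ n ≤ M p q := by
  unfold ch at h; split_ifs at h
  · exact alt_len_le cs h
  · rw [M.symmetric p q]; exact alt_len_le cs h

lemma gam_nonneg {p q : B} (hpq : p ≠ q) {n : ℕ} (h : M p q = 0 ∨ n + 1 ≤ M p q) : 0 ≤ gam M p q n := by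
  have h1 := M.off_diagonal p q hpq
  have a := U_nonneg h h1
  have b := U_nonneg (n := n) (h.imp id (by omega)) h1
  unfold gam
  exact add_nonneg (smul_nonneg a (al_nonneg p)) (smul_nonneg b (al_nonneg q))

lemma gam_v_nonneg {v : W} {p q : B} (hp : 0 ≤ rho cs v (al p)) (hq : 0 ≤ rho cs v (al q)) (hpq : p ≠ q) {n : ℕ} (h : M p q = 0 ∨ n + 1 ≤ M p q) :
    0 ≤ rho cs v (gam M p q n) := by
  have h1 := M.off_diagonal p q hpq
  have a := U_nonneg h h1
  have b := U_nonneg (n := n) (h.imp id (by omega)) h1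
  unfold gam
  rw [map_add, map_smul, map_smul]
  exact add_nonneg (smul_nonneg a hp) (smul_nonneg b hq)

lemma claim {g : W} (hg : ∀ i, cs.IsRightDescent g i → IsElementary cs (g * cs.simple i * g⁻¹))
    (z : W) (hz : WeakLe cs g z) (i : B) (hi : cs.IsRightDescent z i)
    (hne : ¬ IsElementary cs (z * cs.simple i * z⁻¹)) : WeakLe cs g (z * cs.simple i) := by
  induction hl : cs.length z using Nat.strong_induction_on generalizing z i with
  | _ L ih =>
  subst hl
  have hgz : g ≠ z := by rintro rfl; exact hne (hg i hi)
  obtain ⟨k, hk, hgk⟩ := wl_exists hz hgz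
  by_cases hki : k = i
  · rwa [hki] at hgk
  have hi' := (cs.isRightDescent_iff).1 hi
  have hni : ¬ cs.IsRightDescent (z * cs.simple i) i := by
    rw [CoxeterSystem.IsRightDescent]; simp; omega
  obtain ⟨n, v, hv, hlv, hvi, hvk⟩ := exists_alt cs (z * cs.simple i) i k hni
  obtain ⟨p, q, hpq, hch, hxi, hxk, hp, hq⟩ : ∃ p q : B, p ≠ q ∧ alt cs i k n = ch cs q p n ∧ i = xl q p n ∧ k = xl p q n ∧
      0 ≤ rho cs v (al p) ∧ 0 ≤ rho cs v (al q) := by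
    have h1 := sign_pos cs v i hvi
    have h2 := sign_pos cs v k hvk
    by_cases h : Even n
    · exact ⟨k, i, hki, by simp [ch, h], by simp [xl, h], by simp [xl, h], h2, h1⟩
    · exact ⟨i, k, Ne.symm hki, by simp [ch, h], by simp [xl, h], by simp [xl, h], h1, h2⟩
  rw [hch] at hv
  have hzv : z = v * ch cs q p (n+1) := by
    rw [ch_succ, ← mul_assoc, ← hv, ← hxi, cs.simple_mul_simple_cancel_right]
  have hlz : cs.length z = cs.length v + (n+1) := by omega
  have hb := ch_bound (hzv ▸ hlz)
  rw [M.symmetric q p] at hb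
  have hM : M p q = n + 1 := by
    by_contra hMn
    have h0 : 0 ≤ rho cs v (gam M q p (n+1)) := by
      apply gam_v_nonneg hq hp hpq.symm
      rw [M.symmetric q p]; omega
    rw [← ch_root (cs := cs), xl_succ, ← hxk, ← rho_mul, ← hzv] at h0
    exact ((isRoot_al k).rho z).not_both h0 (sign_neg cs z k hk)
  have h2 : 2 ≤ M p q := by
    have := M.off_diagonal p q hpq; omega
  have hzv2 : z = v * ch cs p q (n+1) := by rw [hzv, ← hM, ch_braid]
  have hzk : z * cs.simple k = v * ch cs p q n := by
    rw [hzv2, ch_succ, ← mul_assoc, ← hxk, cs.simple_mul_simple_cancel_right]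
  have hgam : gam M q p n = al p := by
    unfold gam
    have e1 := U_sub h2 (le_refl (M p q))
    have e2 := U_sub h2 (show 1 ≤ M p q by omega)
    have e3 : M p q - 1 = n := by omega
    rw [e3] at e2
    rw [Nat.sub_self] at e1
    rw [M.symmetric q p, ← hM, ← e1, e2]
    simp [U]
  have hNE : NE cs v (al p) := by
    apply NE_of_not_elem hp
    convert hne using 2
    apply rho_inj (cs := cs)
    rw [rho_conj, rho_conj]
    have : rho cs z (al i) = - rho cs v (al p) := by
      have hz' : z = z * cs.simple i * cs.simple i := by simp
      rw [hz', rho_mul, rho_simple, rf_self M (bf_self M i), map_neg, hv, rho_mul, hxi, ch_root, hgam]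
    rw [this, rf_neg]
  have key : ∀ d j, j + d = n → WeakLe cs g (v * ch cs p q j) := by
    intro d
    induction d with
    | zero => intro j hj; obtain rfl : j = n := hj; rwa [← hzk]
    | succ d ihd =>
      intro j hj
      have h1 := ihd (j+1) (by omega)
      have hx : v * ch cs p q (j+1) * cs.simple (xl p q j) = v * ch cs p q j := by
        rw [ch_succ, ← mul_assoc, cs.simple_mul_simple_cancel_right]
      have hroot : rho cs (v * ch cs p q (j+1)) (al (xl p q j)) = - rho cs v (gam M p q j) := by
        rw [ch_succ, rho_mul, rho_mul, rho_simple, rf_self M (bf_self M _), map_neg, map_neg, ch_root]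
      have := ih (cs.length (v * ch cs p q (j+1))) ?_ (v * ch cs p q (j+1)) h1 (xl p q j) ?_ ?_ rfl
      · rwa [hx] at this
      · have a := cs.length_mul_le v (ch cs p q (j+1))
        have b := ch_len_le (cs := cs) p q (j+1)
        omega
      · rw [isRightDescent_iff_neg, hroot]
        have := gam_v_nonneg hp hq hpq (n := j) (by omega)
        simpa using this
      · refine not_elem_of_NE (y := v) (g := gam M p q j) ?_ (gam_nonneg hpq (by omega)) ?_ (NE_gam hp hq hNE j (by omega))
        · rw [← ch_root (cs := cs)]; exact (isRoot_al _).rho _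
        · rw [rho_conj, hroot, rf_neg]
  have hgv := key n 0 (by omega)
  rw [show v * ch cs p q 0 = v by simp [ch, alt]] at hgv
  refine wl_trans hgv ?_
  rw [wl_def, hv, inv_mul_cancel_left, ← hv, hlv]
  have a := ch_len_le (cs := cs) q p n
  have b := cs.length_mul_le v (ch cs q p n)
  rw [← hv] at b
  omega

theorem final (m : W → W)
    (hm : ∀ g : W, SameShiPart cs g (m g) ∧
      ∀ h : W, SameShiPart cs g h → WeakLe cs (m g) h) :
    (∀ i : B, cs.simple i ∈ Set.range m) ∧
    (∀ h ∈ Set.range m, ∀ g : W, WeakLe cs g h → g⁻¹ * h ∈ Set.range m) ∧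
    (∀ g ∈ Set.range m, ∀ g' ∈ Set.range m, ∀ j : W,
      IsJoin cs g g' j → j ∈ Set.range m) := by
  simp only [range_iff m hm]
  refine ⟨cond1, fun h H g hw => cond2 hw H, ?_⟩
  rintro g hg g' hg' j ⟨h1, h2, h3⟩ i hi
  by_contra hne
  exact desc_not_wl hi (h3 _ (claim hg j h1 i hi hne) (claim hg' j h2 i hi hne))
end fin
end Gar

/-- `M = {m(g) : g ∈ W}` is a Garside shadow: it contains `S`, contains `g⁻¹h`
whenever `h ∈ M` and `g ⪯ h`, and contains every existing join of its elements. -/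
theorem M_isGarsideShadow [Finite B] (cs : CoxeterSystem M W) (m : W → W)
    (hm : ∀ g : W, SameShiPart cs g (m g) ∧
      ∀ h : W, SameShiPart cs g h → WeakLe cs (m g) h) :
    (∀ i : B, cs.simple i ∈ Set.range m) ∧
    (∀ h ∈ Set.range m, ∀ g : W, WeakLe cs g h → g⁻¹ * h ∈ Set.range m) ∧
    (∀ g ∈ Set.range m, ∀ g' ∈ Set.range m, ∀ j : W,
      IsJoin cs g g' j → j ∈ Set.range m) := by
  classical
  haveI := Fintype.ofFinite B
  exact Gar.final m hm
end

section
/- Every cone type part of W has a smallest element with respect to the weak order ⪯. -/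
/-!
Let `(W,S)` be a Coxeter system, given by a Coxeter matrix `M : CoxeterMatrix B`
and `cs : CoxeterSystem M W`; the set `S` of simple reflections is the range of
`cs.simple`, and `S` is finite since `B` is finite.
-/

variable {B W : Type*} [Group W] {M : CoxeterMatrix B}

/-- The cone type of `g`: `T(g) = {h ∈ W : ℓ(gh) = ℓ(g) + ℓ(h)}`. -/
def ConeType (cs : CoxeterSystem M W) (g : W) : Set W :=
  {h : W | cs.length (g * h) = cs.length g + cs.length h}


open Classical in
/-- parity action -/
noncomputable def parAct (cs : CoxeterSystem M W) (i : B) : Function.End (W × ZMod 2) :=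
  fun x => (cs.simple i * x.1 * (cs.simple i)⁻¹, x.2 + if x.1 = cs.simple i then 1 else 0)

open Classical in
theorem parAct_pow (cs : CoxeterSystem M W) (i j : B) (n : ℕ) (t : W) (ε : ZMod 2) :
    ((parAct cs i * parAct cs j) ^ n) (t, ε) =
      ((cs.simple i * cs.simple j) ^ n * t * ((cs.simple i * cs.simple j) ^ n)⁻¹,
       ε + ∑ k ∈ Finset.range (2 * n),
        if t = ((cs.simple i * cs.simple j) ^ k)⁻¹ * cs.simple j then 1 else 0) := by
  induction n with
  | zero => simp; rfl
  | succ n ih =>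
    have hj : ∀ k : ℕ, cs.simple j * ((cs.simple i * cs.simple j) ^ k) =
        ((cs.simple i * cs.simple j) ^ k)⁻¹ * cs.simple j := by
      intro k
      induction k with
      | zero => simp
      | succ k ihk =>
        rw [pow_succ, ← mul_assoc, ihk, ← pow_succ, pow_succ', mul_inv_rev, mul_assoc, mul_assoc,
          mul_inv_rev, cs.inv_simple, cs.inv_simple]
        simp [mul_assoc]
    have e1 : ((cs.simple i * cs.simple j) ^ n * t * ((cs.simple i * cs.simple j) ^ n)⁻¹
        = cs.simple j) ↔ t = ((cs.simple i * cs.simple j) ^ (2 * n))⁻¹ * cs.simple j := by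
      rw [two_mul, pow_add, mul_inv_rev, mul_assoc _ _ (cs.simple j), ← hj, mul_inv_eq_iff_eq_mul,
        eq_inv_mul_iff_mul_eq]
    have e2 : (cs.simple j * ((cs.simple i * cs.simple j) ^ n * t *
        ((cs.simple i * cs.simple j) ^ n)⁻¹) * (cs.simple j)⁻¹
        = cs.simple i) ↔ t = ((cs.simple i * cs.simple j) ^ (2 * n + 1))⁻¹ * cs.simple j := by
      have : ((cs.simple i * cs.simple j) ^ (2 * n + 1))⁻¹ * cs.simple j =
          ((cs.simple i * cs.simple j) ^ n)⁻¹ *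
          ((cs.simple j)⁻¹ * cs.simple i * cs.simple j) * (cs.simple i * cs.simple j) ^ n := by
        rw [mul_assoc _ _ ((cs.simple i * cs.simple j) ^ n), mul_assoc _ _ ((cs.simple i * cs.simple j) ^ n), hj,
          show 2 * n + 1 = n + 1 + n by ring, pow_add, pow_succ]
        have h2 : (cs.simple j)⁻¹ * cs.simple i = (cs.simple i * cs.simple j)⁻¹ := by
          simp
        rw [h2, mul_inv_rev, mul_inv_rev]
        have h3 : (cs.simple i * cs.simple j)⁻¹ * ((cs.simple i * cs.simple j) ^ n)⁻¹ =
          ((cs.simple i * cs.simple j) ^ n)⁻¹ * (cs.simple i * cs.simple j)⁻¹ := by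
          rw [← mul_inv_rev, ← mul_inv_rev, ← pow_succ, ← pow_succ']
        rw [← mul_assoc (cs.simple i * cs.simple j)⁻¹, h3]
        simp only [mul_assoc]
      rw [this]
      generalize (cs.simple i * cs.simple j) ^ n = q
      constructor
      · intro h
        rw [← h]; group
      · intro h
        rw [h]; group
    rw [pow_succ']
    change (parAct cs i * parAct cs j) (((parAct cs i * parAct cs j) ^ n) (t, ε)) = _
    rw [ih, show 2 * (n + 1) = 2 * n + 1 + 1 by ring, Finset.sum_range_succ, Finset.sum_range_succ]
    change parAct cs i (parAct cs j _) = _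
    simp only [parAct, e1, e2]
    ext
    · simp only [pow_succ', mul_inv_rev, mul_assoc]
    · simp only [add_assoc]

theorem parAct_liftable (cs : CoxeterSystem M W) : M.IsLiftable (parAct cs) := by
  classical
  intro i j
  funext ⟨t, ε⟩
  rw [parAct_pow, two_mul, Finset.sum_range_add]
  simp only [pow_add, cs.simple_mul_simple_pow, one_mul]
  rw [CharTwo.add_self_eq_zero]
  simp; rfl

/-- lifted action -/
noncomputable def parHom (cs : CoxeterSystem M W) : W →* Function.End (W × ZMod 2) :=
  cs.lift ⟨parAct cs, parAct_liftable cs⟩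

/-- parity of inversions -/
noncomputable def par (cs : CoxeterSystem M W) (w t : W) : ZMod 2 := (parHom cs w (t, 0)).2

theorem parHom_simple (cs : CoxeterSystem M W) (i : B) : parHom cs (cs.simple i) = parAct cs i :=
  cs.lift_apply_simple (parAct_liftable cs) i

theorem parHom_word (cs : CoxeterSystem M W) (ω : List B) (t : W) :
    ∃ c : ZMod 2, (c ≠ 0 → t ∈ cs.rightInvSeq ω) ∧ ∀ ε,
      parHom cs (cs.wordProd ω) (t, ε) = (cs.wordProd ω * t * (cs.wordProd ω)⁻¹, ε + c) := by
  classical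
  induction ω with
  | nil => exact ⟨0, by simp, fun ε => by simp; rfl⟩
  | cons i ω ih =>
    obtain ⟨c, hc, h⟩ := ih
    refine ⟨c + if cs.wordProd ω * t * (cs.wordProd ω)⁻¹ = cs.simple i then 1 else 0, ?_, ?_⟩
    · intro h0
      rw [CoxeterSystem.rightInvSeq, List.mem_cons]
      split_ifs at h0 with h1
      · left
        rw [← h1]; group
      · right; exact hc (by simpa using h0)
    · intro ε
      rw [cs.wordProd_cons, map_mul]
      change parHom cs _ (parHom cs _ _) = _
      rw [h, parHom_simple]
      simp only [parAct]
      ext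
      · simp only; group
      · simp only [add_assoc]

theorem parHom_eq (cs : CoxeterSystem M W) (w t : W) (ε : ZMod 2) :
    parHom cs w (t, ε) = (w * t * w⁻¹, ε + par cs w t) := by
  obtain ⟨ω, rfl⟩ := cs.wordProd_surjective w
  obtain ⟨c, hc, h⟩ := parHom_word cs ω t
  rw [par, h, h]; simp

theorem par_mul (cs : CoxeterSystem M W) (u v t : W) :
    par cs (u * v) t = par cs v t + par cs u (v * t * v⁻¹) := by
  rw [par, map_mul]
  change (parHom cs u (parHom cs v _)).2 = _
  rw [parHom_eq, parHom_eq]; simp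

theorem par_simple (cs : CoxeterSystem M W) (i : B) : par cs (cs.simple i) (cs.simple i) = 1 := by
  rw [par, parHom_simple]; simp [parAct]

theorem par_lt (cs : CoxeterSystem M W) {w t : W} (h : par cs w t ≠ 0) :
    cs.length (w * t) < cs.length w := by
  obtain ⟨ω, hω, rfl⟩ := cs.exists_isReduced w
  obtain ⟨c, hc, h'⟩ := parHom_word cs ω t
  rw [par, h'] at h
  exact (cs.isRightInversion_of_mem_rightInvSeq hω (hc (by simpa using h))).2

theorem par_of_lt (cs : CoxeterSystem M W) {w : W} {i : B}
    (h : cs.length (w * cs.simple i) < cs.length w) : par cs w (cs.simple i) = 1 := by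
  have h1 := par_mul cs (w * cs.simple i) (cs.simple i) (cs.simple i)
  rw [cs.simple_mul_simple_cancel_right, par_simple] at h1
  have h2 : par cs (w * cs.simple i) (cs.simple i) = 0 := by
    by_contra h3
    have := par_lt cs h3
    rw [cs.simple_mul_simple_cancel_right] at this
    omega
  rw [h1]; simp [h2]

/-- exchange -/
theorem weak_exchange (cs : CoxeterSystem M W) {u z : W} {i : B} (huz : WeakLe cs u z)
    (hz : cs.length (cs.simple i * z) < cs.length z)
    (hu : cs.length u < cs.length (cs.simple i * u)) : WeakLe cs (cs.simple i * u) z := by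
  have e : ∀ w : W, cs.length (w⁻¹ * cs.simple i) = cs.length (cs.simple i * w) := by
    intro w; rw [← cs.length_inv]; simp
  have h1 : par cs z⁻¹ (cs.simple i) = 1 := par_of_lt cs (by rw [e, cs.length_inv]; exact hz)
  have h2 : par cs u⁻¹ (cs.simple i) = 0 := by
    by_contra h3
    have := par_lt cs h3
    rw [e, cs.length_inv] at this; omega
  have h3 := par_mul cs (z⁻¹ * u) u⁻¹ (cs.simple i)
  rw [mul_inv_cancel_right, h1, h2, zero_add] at h3
  have h4 := par_lt cs (w := z⁻¹ * u) (t := u⁻¹ * cs.simple i * u⁻¹⁻¹) (by rw [← h3]; simp)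
  have h5 : cs.length (z⁻¹ * u * (u⁻¹ * cs.simple i * u⁻¹⁻¹)) =
      cs.length ((cs.simple i * u)⁻¹ * z) := by
    rw [← cs.length_inv]; congr 1; simp [mul_assoc]
  have h6 : cs.length (z⁻¹ * u) = cs.length (u⁻¹ * z) := by rw [← cs.length_inv]; simp
  rw [h5, h6] at h4
  unfold WeakLe at *
  have h7 := cs.length_mul_le (cs.simple i * u) ((cs.simple i * u)⁻¹ * z)
  rw [mul_inv_cancel_left] at h7
  have h8 := cs.length_simple_mul u i
  omega

theorem WeakLe.trans' {cs : CoxeterSystem M W} {a b c : W} (h1 : WeakLe cs a b)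
    (h2 : WeakLe cs b c) : WeakLe cs a c := by
  unfold WeakLe at *
  have h3 := cs.length_mul_le (a⁻¹ * b) (b⁻¹ * c)
  have h4 := cs.length_mul_le a (a⁻¹ * c)
  simp only [mul_assoc, mul_inv_cancel_left] at h3 h4
  omega

theorem WeakLe.refl' (cs : CoxeterSystem M W) (a : W) : WeakLe cs a a := by
  simp [WeakLe]

/-- translating: if `a ⪯ x` and `j ⪯ a⁻¹x` then `a j ⪯ x` and `a ⪯ a j`. -/
theorem WeakLe.transl {cs : CoxeterSystem M W} {a j x : W} (h1 : WeakLe cs a x)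
    (h2 : WeakLe cs j (a⁻¹ * x)) : WeakLe cs (a * j) x ∧ WeakLe cs a (a * j) := by
  unfold WeakLe at *
  have h3 := cs.length_mul_le a j
  have h4 := cs.length_mul_le (a * j) ((a * j)⁻¹ * x)
  simp only [mul_inv_rev, mul_assoc, mul_inv_cancel_left, inv_mul_cancel_left] at *
  omega

theorem WeakLe.untransl {cs : CoxeterSystem M W} {a b x : W} (h1 : WeakLe cs a b)
    (h2 : WeakLe cs b x) : WeakLe cs (a⁻¹ * b) (a⁻¹ * x) := by
  have h0 := h1.trans' h2
  unfold WeakLe at *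
  simp only [mul_inv_rev, inv_inv, mul_assoc, mul_inv_cancel_left] at *
  omega

theorem weakLe_simple (cs : CoxeterSystem M W) (i : B) (x : W) :
    WeakLe cs (cs.simple i) x ↔ cs.length (cs.simple i * x) < cs.length x := by
  unfold WeakLe
  rw [cs.inv_simple, cs.length_simple]
  have := cs.length_simple_mul x i
  omega

/-- alternating products -/
def altProd (cs : CoxeterSystem M W) : ℕ → B → B → W
  | 0, _, _ => 1
  | k + 1, i, j => cs.simple i * altProd cs k j i

theorem weak_local (cs : CoxeterSystem M W) (i j : B) (x y : W)
    (hix : WeakLe cs (cs.simple i) x) (hjx : WeakLe cs (cs.simple j) x)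
    (hiy : WeakLe cs (cs.simple i) y) (hjy : WeakLe cs (cs.simple j) y) :
    ∃ d, WeakLe cs (cs.simple i) d ∧ WeakLe cs (cs.simple j) d ∧ WeakLe cs d x ∧ WeakLe cs d y := by
  by_contra hcon
  push Not at hcon
  have key : ∀ k : ℕ,
      (cs.length (altProd cs (k + 1) i j) = k + 1 ∧ cs.length (altProd cs (k + 1) j i) = k + 1) ∧
      (WeakLe cs (altProd cs (k + 1) i j) x ∧ WeakLe cs (altProd cs (k + 1) i j) y) ∧
      (WeakLe cs (altProd cs (k + 1) j i) x ∧ WeakLe cs (altProd cs (k + 1) j i) y) ∧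
      (WeakLe cs (cs.simple i) (altProd cs (k + 1) i j) ∧
        WeakLe cs (cs.simple j) (altProd cs (k + 1) j i)) := by
    intro k
    induction k with
    | zero => simp [altProd, *, WeakLe.refl']
    | succ k ih =>
      obtain ⟨⟨l1, l2⟩, ⟨a1, a2⟩, ⟨b1, b2⟩, c1, c2⟩ := ih
      have n1 : ¬ WeakLe cs (cs.simple j) (altProd cs (k + 1) i j) :=
        fun h => hcon _ c1 h a1 a2
      have n2 : ¬ WeakLe cs (cs.simple i) (altProd cs (k + 1) j i) :=
        fun h => hcon _ h c2 b1 b2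
      rw [weakLe_simple] at n1 n2 hix hjx hiy hjy
      have m1 := cs.length_simple_mul (altProd cs (k + 1) i j) j
      have m2 := cs.length_simple_mul (altProd cs (k + 1) j i) i
      have q1 : altProd cs (k + 1 + 1) i j = cs.simple i * altProd cs (k + 1) j i := rfl
      have q2 : altProd cs (k + 1 + 1) j i = cs.simple j * altProd cs (k + 1) i j := rfl
      rw [q1, q2]
      refine ⟨⟨by omega, by omega⟩, ⟨weak_exchange cs b1 hix (by omega),
        weak_exchange cs b2 hiy (by omega)⟩, ⟨weak_exchange cs a1 hjx (by omega),
        weak_exchange cs a2 hjy (by omega)⟩, ?_, ?_⟩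
      · rw [weakLe_simple, cs.simple_mul_simple_cancel_left]; omega
      · rw [weakLe_simple, cs.simple_mul_simple_cancel_left]; omega
  obtain ⟨⟨l1, -⟩, ⟨a1, -⟩, -⟩ := key (cs.length x)
  unfold WeakLe at a1
  omega

theorem weak_first (cs : CoxeterSystem M W) {a u : W} (h : WeakLe cs a u) (hne : a ≠ u) :
    ∃ i, WeakLe cs (cs.simple i) (a⁻¹ * u) := by
  have : a⁻¹ * u ≠ 1 := fun h => hne (inv_mul_eq_one.1 h)
  obtain ⟨i, hi⟩ := cs.exists_leftDescent_of_ne_one this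
  exact ⟨i, (weakLe_simple _ _ _).2 hi⟩

theorem weak_meet_aux (cs : CoxeterSystem M W) (x y : W) (n : ℕ) : ∀ a : W,
    cs.length x ≤ cs.length a + n → WeakLe cs a x → WeakLe cs a y →
    ∃ d, WeakLe cs d x ∧ WeakLe cs d y ∧
      ∀ u, WeakLe cs u x → WeakLe cs u y → WeakLe cs a u → WeakLe cs u d := by
  induction n with
  | zero =>
    intro a hn hx hy
    refine ⟨a, hx, hy, fun u hux huy hau => ?_⟩
    have : a⁻¹ * u = 1 := by
      rw [← cs.length_eq_zero_iff]
      unfold WeakLe at *; omega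
    rw [inv_mul_eq_one.1 this]; exact WeakLe.refl' _ _
  | succ n ih =>
    intro a hn hx hy
    have ih' : ∀ i, WeakLe cs (cs.simple i) (a⁻¹ * x) → WeakLe cs (cs.simple i) (a⁻¹ * y) →
      ∃ d, WeakLe cs d x ∧ WeakLe cs d y ∧ ∀ u, WeakLe cs u x → WeakLe cs u y →
        WeakLe cs (a * cs.simple i) u → WeakLe cs u d := by
      intro i hi hi'
      refine ih _ ?_ (hx.transl hi).1 (hy.transl hi').1
      have := (hx.transl hi).2
      unfold WeakLe at this
      rw [inv_mul_cancel_left, cs.length_simple] at this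
      omega
    by_cases hc : ∃ i, WeakLe cs (cs.simple i) (a⁻¹ * x) ∧ WeakLe cs (cs.simple i) (a⁻¹ * y)
    · obtain ⟨i, hi, hi'⟩ := hc
      obtain ⟨d, dx, dy, hd⟩ := ih' i hi hi'
      refine ⟨d, dx, dy, fun u hux huy hau => ?_⟩
      by_cases hne : a = u
      · subst hne
        have h1 := hx.transl hi
        exact h1.2.trans' (hd _ h1.1 (hy.transl hi').1 (WeakLe.refl' _ _))
      obtain ⟨j, hj⟩ := weak_first cs hau hne
      have hjx := hj.trans' (hau.untransl hux)
      have hjy := hj.trans' (hau.untransl huy)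
      obtain ⟨d', dx', dy', hd'⟩ := ih' j hjx hjy
      obtain ⟨e, ei, ej, ex, ey⟩ := weak_local cs i j _ _ hi hjx hi' hjy
      have hae := hx.transl ex
      have hae' := hy.transl ey
      have t : ∀ k, WeakLe cs (cs.simple k) e → WeakLe cs (a * cs.simple k) (a * e) := by
        intro k hk
        exact (hae.2.transl (by rwa [inv_mul_cancel_left])).1
      exact (hd' u hux huy (hau.transl hj).1).trans'
        (hd d' dx' dy' ((t i ei).trans' (hd' _ hae.1 hae'.1 (t j ej))))
    · refine ⟨a, hx, hy, fun u hux huy hau => ?_⟩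
      by_cases hne : a = u
      · rw [hne]; exact WeakLe.refl' _ _
      obtain ⟨j, hj⟩ := weak_first cs hau hne
      exact absurd ⟨j, hj.trans' (hau.untransl hux), hj.trans' (hau.untransl huy)⟩ hc

theorem weakLe_one (cs : CoxeterSystem M W) (x : W) : WeakLe cs 1 x := by simp [WeakLe]

theorem weak_meet (cs : CoxeterSystem M W) (x y : W) :
    ∃ d, WeakLe cs d x ∧ WeakLe cs d y ∧
      ∀ u, WeakLe cs u x → WeakLe cs u y → WeakLe cs u d := by
  obtain ⟨d, h1, h2, h3⟩ := weak_meet_aux cs x y (cs.length x) 1 (by omega)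
    (weakLe_one _ _) (weakLe_one _ _)
  exact ⟨d, h1, h2, fun u a b => h3 u a b (weakLe_one _ _)⟩

theorem mem_cone (cs : CoxeterSystem M W) (x h : W) :
    h ∈ ConeType cs x⁻¹ ↔ WeakLe cs h⁻¹ (h⁻¹ * x) := by
  unfold ConeType WeakLe
  rw [Set.mem_ofPred_eq, ← cs.length_inv (x⁻¹ * h)]
  simp only [mul_inv_rev, inv_inv, cs.length_inv, mul_inv_cancel_left]
  omega

theorem cone_anti (cs : CoxeterSystem M W) {m x : W} (h : WeakLe cs m x) :
    ConeType cs x⁻¹ ⊆ ConeType cs m⁻¹ := by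
  intro k hk
  unfold ConeType at *
  rw [Set.mem_ofPred_eq] at *
  unfold WeakLe at h
  have h1 := cs.length_mul_le (x⁻¹ * m) (m⁻¹ * k)
  have h2 := cs.length_mul_le m⁻¹ k
  have h3 := cs.length_inv (m⁻¹ * x)
  simp only [mul_inv_rev, inv_inv, mul_assoc, mul_inv_cancel_left, cs.length_inv] at *
  omega

theorem cone_meet (cs : CoxeterSystem M W) {x y m : W} (hxy : ConeType cs x⁻¹ = ConeType cs y⁻¹)
    (hmx : WeakLe cs m x)
    (hm : ∀ u, WeakLe cs u x → WeakLe cs u y → WeakLe cs u m) :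
    ConeType cs m⁻¹ = ConeType cs x⁻¹ := by
  refine Set.Subset.antisymm ?_ (cone_anti cs hmx)
  have main : ∀ n : ℕ, ∀ h : W, cs.length h = n → h ∈ ConeType cs m⁻¹ → h ∈ ConeType cs x⁻¹ := by
    intro n
    induction n with
    | zero =>
      intro h h0 _
      rw [cs.length_eq_zero_iff] at h0
      subst h0; simp [ConeType]
    | succ n ih =>
      intro h hn hh
      by_contra hcon
      have hne : h ≠ 1 := by rintro rfl; simp at hn
      obtain ⟨i, hi⟩ := cs.exists_rightDescent_of_ne_one hne
      obtain ⟨k, rfl⟩ : ∃ k, h = k * cs.simple i := ⟨h * cs.simple i, by simp⟩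
      rw [cs.isRightDescent_iff, cs.simple_mul_simple_cancel_right] at hi
      have hkn : cs.length k = n := by omega
      -- k in cone of m
      have hkm : k ∈ ConeType cs m⁻¹ := by
        unfold ConeType at *
        rw [Set.mem_ofPred_eq] at *
        have h1 := cs.length_mul_le (m⁻¹ * k) (cs.simple i)
        have h2 := cs.length_mul_le m⁻¹ k
        rw [cs.length_simple] at h1
        rw [← mul_assoc] at hh
        omega
      have hkx := ih k hkn hkm
      have hky : k ∈ ConeType cs y⁻¹ := hxy ▸ hkx
      have hcony : k * cs.simple i ∉ ConeType cs y⁻¹ := hxy ▸ hcon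
      -- descent criterion
      have crit : ∀ z, k ∈ ConeType cs z⁻¹ →
          (k * cs.simple i ∉ ConeType cs z⁻¹ ↔ WeakLe cs (cs.simple i) (k⁻¹ * z)) := by
        intro z hz
        unfold ConeType at *
        rw [Set.mem_ofPred_eq] at *
        rw [weakLe_simple]
        have e1 := cs.length_inv (z⁻¹ * k)
        have e2 := cs.length_inv (z⁻¹ * (k * cs.simple i))
        simp only [mul_inv_rev, inv_inv, mul_assoc, cs.inv_simple] at e1 e2
        have e3 := cs.length_simple_mul (k⁻¹ * z) i
        omega
      have sx := (crit x hkx).1 hcon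
      have sy := (crit y hky).1 hcony
      obtain ⟨d, dx, dy, hd⟩ := weak_meet cs (k⁻¹ * x) (k⁻¹ * y)
      have kd := hd _ ((mem_cone cs x k).1 hkx) ((mem_cone cs y k).1 hky)
      have sd := hd _ sx sy
      have a1 := kd.untransl dx
      have a2 := kd.untransl dy
      simp only [inv_inv, mul_inv_cancel_left] at a1 a2
      have a3 := hm _ a1 a2
      have kc : k ∈ ConeType cs (k * d)⁻¹ := by
        rw [mem_cone, inv_mul_cancel_left]; exact kd
      have a4 := (crit (k * d) kc).2 (by rwa [inv_mul_cancel_left])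
      exact a4 (cone_anti cs a3 hh)
  exact fun h hh => main _ h rfl hh

/-- Every cone type part of `W` has a smallest element with respect to the weak order. -/
theorem cone_type_part_has_smallest [Finite B] (cs : CoxeterSystem M W) (g : W) :
    ∃ p : W, ConeType cs p⁻¹ = ConeType cs g⁻¹ ∧
      ∀ h : W, ConeType cs h⁻¹ = ConeType cs g⁻¹ → WeakLe cs p h := by
  have hex : ∃ n : ℕ, ∃ p, ConeType cs p⁻¹ = ConeType cs g⁻¹ ∧ cs.length p = n := ⟨_, g, rfl, rfl⟩
  classical
  obtain ⟨p, hp, hpn⟩ := Nat.find_spec hex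
  refine ⟨p, hp, fun h hh => ?_⟩
  obtain ⟨m, mp, mh, hm⟩ := weak_meet cs p h
  have h1 := cone_meet cs (hp.trans hh.symm) mp hm
  have h2 := Nat.find_min' hex ⟨m, h1.trans hp, rfl⟩
  have h3 : m⁻¹ * p = 1 := by
    rw [← cs.length_eq_zero_iff]
    unfold WeakLe at mp; omega
  rw [← inv_mul_eq_one.1 h3]; exact mh
end
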